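/- For every ε > 0 there exists a constant C > 0 (depending only on ε and on γ) such that for every positive integer m which is a sum of two squares, | ∫₀ᴸ ∫₀ᴸ ( r₁₂(t₁,t₂) / (4π²m) )² dt₁ dt₂ − B_C(E)/N | ≤ C · N^{ε−2}, where N = #{μ ∈ ℤ² : μ₁² + μ₂² = m}, r₁₂ = ∂²r/∂t₁∂t₂, and B_C(E) = ∫₀ᴸ∫₀ᴸ N^{-1} Σ_{μ∈E} ⟨μ/‖μ‖, γ'(t₁)⟩² · ⟨μ/‖μ‖, γ'(t₂)⟩² dt₁ dt₂. -/

import Mathlib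

open MeasureTheory ProbabilityTheory Real

noncomputable section

/-- The set of lattice points on the circle of radius `√m`:
`E = {μ ∈ ℤ² : μ₁² + μ₂² = m}` (all solutions satisfy `|μᵢ| ≤ m`). -/
def latticeSet (m : ℕ) : Finset (ℤ × ℤ) :=
  (Finset.Icc (-(m : ℤ)) (m : ℤ) ×ˢ Finset.Icc (-(m : ℤ)) (m : ℤ)).filter
    (fun μ => μ.1 ^ 2 + μ.2 ^ 2 = (m : ℤ))

/-- `N = #E`, the number of lattice points on the circle of radius `√m`. -/
def latN (m : ℕ) : ℕ := (latticeSet m).card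

/-- The covariance function of the wave restricted to the curve:
`r(t₁,t₂) = N⁻¹ ∑_{μ ∈ E} cos(2π⟨μ, γ(t₁) − γ(t₂)⟩)`. -/
def covFn (m : ℕ) (γ : ℝ → ℝ × ℝ) (t₁ t₂ : ℝ) : ℝ :=
  ((latN m : ℝ))⁻¹ *
    ∑ μ ∈ latticeSet m,
      Real.cos (2 * π * ((μ.1 : ℝ) * (γ t₁ - γ t₂).1 + (μ.2 : ℝ) * (γ t₁ - γ t₂).2))

/-- `r₁ = ∂r/∂t₁`. -/
def covFn1 (m : ℕ) (γ : ℝ → ℝ × ℝ) (t₁ t₂ : ℝ) : ℝ :=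
  deriv (fun s => covFn m γ s t₂) t₁

/-- `r₂ = ∂r/∂t₂`. -/
def covFn2 (m : ℕ) (γ : ℝ → ℝ × ℝ) (t₁ t₂ : ℝ) : ℝ :=
  deriv (fun s => covFn m γ t₁ s) t₂

/-- `r₁₂ = ∂²r/∂t₁∂t₂`. -/
def covFn12 (m : ℕ) (γ : ℝ → ℝ × ℝ) (t₁ t₂ : ℝ) : ℝ :=
  deriv (fun s => deriv (fun u => covFn m γ s u) t₂) t₁

/-- The constant
`B_𝒞(E) = ∫₀ᴸ∫₀ᴸ N⁻¹ ∑_{μ ∈ E} ⟨μ/‖μ‖, γ'(t₁)⟩² ⟨μ/‖μ‖, γ'(t₂)⟩² dt₁ dt₂`. -/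
def Bconst (m : ℕ) (γ : ℝ → ℝ × ℝ) (L : ℝ) : ℝ :=
  ∫ t₁ in (0:ℝ)..L, ∫ t₂ in (0:ℝ)..L,
    ((latN m : ℝ))⁻¹ *
      ∑ μ ∈ latticeSet m,
        (((μ.1 : ℝ) / Real.sqrt ((μ.1 : ℝ) ^ 2 + (μ.2 : ℝ) ^ 2) * (deriv γ t₁).1 +
          (μ.2 : ℝ) / Real.sqrt ((μ.1 : ℝ) ^ 2 + (μ.2 : ℝ) ^ 2) * (deriv γ t₁).2) ^ 2 *
         ((μ.1 : ℝ) / Real.sqrt ((μ.1 : ℝ) ^ 2 + (μ.2 : ℝ) ^ 2) * (deriv γ t₂).1 +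
          (μ.2 : ℝ) / Real.sqrt ((μ.1 : ℝ) ^ 2 + (μ.2 : ℝ) ^ 2) * (deriv γ t₂).2) ^ 2)

theorem integral_sq_deriv_div_le {L K : ℝ} (hL : 0 < L) {ψ ψ₁ ψ₂ : ℝ → ℝ}
    (hψ : ∀ t, HasDerivAt ψ (ψ₁ t) t) (hψ₁ : ∀ t, HasDerivAt ψ₁ (ψ₂ t) t)
    (hc₂ : Continuous ψ₂) (hK₁ : ∀ t ∈ Set.Icc 0 L, |ψ₁ t| ≤ K)
    (hK₂ : ∀ t ∈ Set.Icc 0 L, |ψ₂ t| ≤ K) {s : ℝ} (hs : 0 < s) :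
    ∫ t in (0 : ℝ)..L, ψ₁ t ^ 2 / (1 + (s * ψ t) ^ 2) ≤ (2 * K + L * K) * (π / 2) / s := by
  have hc : Continuous ψ := continuous_iff_continuousAt.2 fun t => (hψ t).continuousAt
  have hc₁ : Continuous ψ₁ := continuous_iff_continuousAt.2 fun t => (hψ₁ t).continuousAt
  have hd : ∀ t, HasDerivAt (fun t => ψ₁ t * arctan (s * ψ t))
      (ψ₂ t * arctan (s * ψ t) + s * (ψ₁ t ^ 2 / (1 + (s * ψ t) ^ 2))) t := by
    intro t
    refine ((hψ₁ t).mul ((hψ t).const_mul s).arctan).congr_deriv ?_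
    ring
  have hpos : ∀ t, 1 + (s * ψ t) ^ 2 ≠ 0 := fun t => by positivity
  have hca : Continuous fun t => ψ₂ t * arctan (s * ψ t) :=
    hc₂.mul (continuous_arctan.comp (continuous_const.mul hc))
  have hcb : Continuous fun t => s * (ψ₁ t ^ 2 / (1 + (s * ψ t) ^ 2)) := by
    fun_prop (disch := assumption)
  have h := intervalIntegral.integral_eq_sub_of_hasDerivAt (a := 0) (b := L)
    (fun t _ => hd t) ((hca.add hcb).intervalIntegrable _ _)
  rw [intervalIntegral.integral_add (hca.intervalIntegrable _ _) (hcb.intervalIntegrable _ _),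
    intervalIntegral.integral_const_mul] at h
  have hat : ∀ u, |arctan u| ≤ π / 2 := fun u =>
    abs_le.2 ⟨(neg_pi_div_two_lt_arctan u).le, (arctan_lt_pi_div_two u).le⟩
  have hprod : ∀ a u, |a| ≤ K → |a * arctan u| ≤ K * (π / 2) := fun a u ha => by
    rw [abs_mul]
    exact mul_le_mul ha (hat u) (abs_nonneg _) ((abs_nonneg _).trans ha)
  have hi : |∫ t in (0 : ℝ)..L, ψ₂ t * arctan (s * ψ t)| ≤ K * (π / 2) * |L - 0| := by
    rw [← Real.norm_eq_abs]
    refine intervalIntegral.norm_integral_le_of_norm_le_const fun t ht => ?_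
    rw [Set.uIoc_of_le hL.le] at ht
    exact hprod _ _ (hK₂ t ⟨ht.1.le, ht.2⟩)
  rw [sub_zero, abs_of_pos hL] at hi
  have h0 := hprod _ (s * ψ 0) (hK₁ 0 ⟨le_rfl, hL.le⟩)
  have h1 := hprod _ (s * ψ L) (hK₁ L ⟨hL.le, le_rfl⟩)
  rw [abs_le] at hi h0 h1
  rw [le_div_iff₀ hs]
  linarith

theorem integral_inv_one_add_sq_le {L K κ : ℝ} (hL : 0 < L) (hκ : 0 < κ) {ψ ψ₁ ψ₂ : ℝ → ℝ}
    (hψ : ∀ t, HasDerivAt ψ (ψ₁ t) t) (hψ₁ : ∀ t, HasDerivAt ψ₁ (ψ₂ t) t)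
    (hc₂ : Continuous ψ₂) (hK₁ : ∀ t ∈ Set.Icc 0 L, |ψ₁ t| ≤ K)
    (hK₂ : ∀ t ∈ Set.Icc 0 L, |ψ₂ t| ≤ K)
    (hnd : ∀ t ∈ Set.Ioo 0 L, κ ≤ ψ₁ t ^ 2 + κ * ψ t ^ 2) {s : ℝ} (hs : 1 ≤ s) :
    ∫ t in (0 : ℝ)..L, 1 / (1 + (s * ψ t) ^ 2) ≤
      ((2 * K + L * K) * (π / 2) / κ + L) / s := by
  have hs0 : 0 < s := by linarith
  have hc : Continuous ψ := continuous_iff_continuousAt.2 fun t => (hψ t).continuousAt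
  have hc₁ : Continuous ψ₁ := continuous_iff_continuousAt.2 fun t => (hψ₁ t).continuousAt
  have hpos : ∀ t, 1 + (s * ψ t) ^ 2 ≠ 0 := fun t => by positivity
  have hca : Continuous fun t => 1 / (1 + (s * ψ t) ^ 2) := by
    fun_prop (disch := assumption)
  have hcb : Continuous fun t => ψ₁ t ^ 2 / (1 + (s * ψ t) ^ 2) := by
    fun_prop (disch := assumption)
  have hcd : Continuous fun t => κ⁻¹ * (ψ₁ t ^ 2 / (1 + (s * ψ t) ^ 2)) := continuous_const.mul hcb
  have hm : ∫ t in (0 : ℝ)..L, 1 / (1 + (s * ψ t) ^ 2) ≤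
      ∫ t in (0 : ℝ)..L, (κ⁻¹ * (ψ₁ t ^ 2 / (1 + (s * ψ t) ^ 2)) + 1 / s) := by
    refine intervalIntegral.integral_mono_on_of_le_Ioo hL.le (hca.intervalIntegrable _ _)
      ((hcd.add continuous_const).intervalIntegrable _ _) fun t ht => ?_
    have hp : 0 < 1 + (s * ψ t) ^ 2 := by positivity
    have h1 : 1 ≤ κ⁻¹ * ψ₁ t ^ 2 + ψ t ^ 2 := by
      have := mul_le_mul_of_nonneg_left (hnd t ht) (inv_pos.2 hκ).le
      rw [mul_add, inv_mul_cancel₀ hκ.ne', inv_mul_cancel_left₀ hκ.ne'] at this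
      exact this
    have h2 : s * ψ t ^ 2 ≤ 1 + (s * ψ t) ^ 2 := by
      nlinarith [sq_nonneg (ψ t), mul_le_mul_of_nonneg_right hs (sq_nonneg (ψ t))]
    have h3 : ψ t ^ 2 ≤ (1 + (s * ψ t) ^ 2) / s := by
      rw [le_div_iff₀ hs0]; linarith
    rw [div_le_iff₀ hp]
    have h4 : (κ⁻¹ * (ψ₁ t ^ 2 / (1 + (s * ψ t) ^ 2)) + 1 / s) * (1 + (s * ψ t) ^ 2) =
      κ⁻¹ * ψ₁ t ^ 2 + (1 + (s * ψ t) ^ 2) / s := by field_simp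
    rw [h4]; linarith
  rw [intervalIntegral.integral_add (hcd.intervalIntegrable _ _)
    (continuous_const.intervalIntegrable _ _), intervalIntegral.integral_const_mul,
    intervalIntegral.integral_const] at hm
  have h5 := mul_le_mul_of_nonneg_left (integral_sq_deriv_div_le hL hψ hψ₁ hc₂ hK₁ hK₂ hs0)
    (inv_pos.2 hκ).le
  refine hm.trans ((add_le_add_left h5 _).trans (le_of_eq ?_))
  simp only [sub_zero, smul_eq_mul]
  field_simp

theorem abs_integral_mul_cos_le {L K κ : ℝ} (hL : 0 < L) (hκ : 0 < κ)
    {φ ψ ψ₁ ψ₂ A A₁ : ℝ → ℝ} (hφ : ∀ t, HasDerivAt φ (ψ t) t)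
    (hψ : ∀ t, HasDerivAt ψ (ψ₁ t) t) (hψ₁ : ∀ t, HasDerivAt ψ₁ (ψ₂ t) t)
    (hc₂ : Continuous ψ₂) (hA : ∀ t, HasDerivAt A (A₁ t) t) (hcA₁ : Continuous A₁)
    (hK : ∀ t ∈ Set.Icc 0 L, |ψ t| ≤ K)
    (hK₁ : ∀ t ∈ Set.Icc 0 L, |ψ₁ t| ≤ K) (hK₂ : ∀ t ∈ Set.Icc 0 L, |ψ₂ t| ≤ K)
    (hKA : ∀ t ∈ Set.Icc 0 L, |A t| ≤ K) (hKA₁ : ∀ t ∈ Set.Icc 0 L, |A₁ t| ≤ K)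
    (hnd : ∀ t ∈ Set.Ioo 0 L, κ ≤ ψ₁ t ^ 2 + κ * ψ t ^ 2) {s : ℝ} (hs : 1 ≤ s) (c : ℝ) :
    |∫ t in (0 : ℝ)..L, A t * cos (s ^ 2 * φ t + c)| ≤
      (2 * K + (2 * K ^ 2 + K) * ((2 * K + L * K) * (π / 2) / κ + L)) / s := by
  have hs0 : 0 < s := by linarith
  have hK0 : 0 ≤ K := (abs_nonneg _).trans (hK 0 ⟨le_rfl, hL.le⟩)
  have hcφ : Continuous φ := continuous_iff_continuousAt.2 fun t => (hφ t).continuousAt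
  have hc : Continuous ψ := continuous_iff_continuousAt.2 fun t => (hψ t).continuousAt
  have hc₁ : Continuous ψ₁ := continuous_iff_continuousAt.2 fun t => (hψ₁ t).continuousAt
  have hcA : Continuous A := continuous_iff_continuousAt.2 fun t => (hA t).continuousAt
  have hpos : ∀ t, 1 + (s * ψ t) ^ 2 ≠ 0 := fun t => by positivity
  have hpos2 : ∀ t, (1 + (s * ψ t) ^ 2) ^ 2 ≠ 0 := fun t => by positivity
  let H : ℝ → ℝ := fun t => A t * (ψ t / (1 + (s * ψ t) ^ 2))
  let H₁ : ℝ → ℝ := fun t => A₁ t * (ψ t / (1 + (s * ψ t) ^ 2)) +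
    A t * (ψ₁ t * (1 - (s * ψ t) ^ 2) / (1 + (s * ψ t) ^ 2) ^ 2)
  have hH : ∀ t, HasDerivAt H (H₁ t) t := by
    intro t
    have h1 : HasDerivAt (fun t => 1 + (s * ψ t) ^ 2) (2 * (s * ψ t) * (s * ψ₁ t)) t := by
      refine ((((hψ t).const_mul s).pow 2).const_add 1).congr_deriv ?_
      simp
    refine ((hA t).mul ((hψ t).div h1 (hpos t))).congr_deriv ?_
    simp only [H₁]
    congr 3
    ring
  have hcH₁ : Continuous H₁ := by
    simp only [H₁]
    fun_prop (disch := assumption)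
  have hca : Continuous fun t => 1 / (1 + (s * ψ t) ^ 2) := by
    fun_prop (disch := assumption)
  have hd : ∀ t, HasDerivAt (fun t => H t * sin (s ^ 2 * φ t + c))
      (A t * cos (s ^ 2 * φ t + c) - (A t * cos (s ^ 2 * φ t + c) * (1 / (1 + (s * ψ t) ^ 2)) -
        H₁ t * sin (s ^ 2 * φ t + c))) t := by
    intro t
    refine ((hH t).mul (((hφ t).const_mul (s ^ 2)).add_const c).sin).congr_deriv ?_
    simp only [H]
    have := hpos t
    field_simp
    ring
  have hc1 : Continuous fun t => A t * cos (s ^ 2 * φ t + c) := by fun_prop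
  have hc2 : Continuous fun t => A t * cos (s ^ 2 * φ t + c) * (1 / (1 + (s * ψ t) ^ 2)) -
        H₁ t * sin (s ^ 2 * φ t + c) :=
    (hc1.mul hca).sub (hcH₁.mul (by fun_prop))
  have h := intervalIntegral.integral_eq_sub_of_hasDerivAt (a := 0) (b := L)
    (fun t _ => hd t) ((hc1.sub hc2).intervalIntegrable _ _)
  rw [intervalIntegral.integral_sub (hc1.intervalIntegrable _ _) (hc2.intervalIntegrable _ _)] at h
  have hI := integral_inv_one_add_sq_le hL hκ hψ hψ₁ hc₂ hK₁ hK₂ hnd hs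
  have hR : |∫ t in (0 : ℝ)..L, (A t * cos (s ^ 2 * φ t + c) * (1 / (1 + (s * ψ t) ^ 2)) -
        H₁ t * sin (s ^ 2 * φ t + c))| ≤
      ∫ t in (0 : ℝ)..L, (2 * K ^ 2 + K) * (1 / (1 + (s * ψ t) ^ 2)) := by
    have hcd : Continuous fun t => (2 * K ^ 2 + K) * (1 / (1 + (s * ψ t) ^ 2)) :=
      continuous_const.mul hca
    rw [← Real.norm_eq_abs]
    refine intervalIntegral.norm_integral_le_of_norm_le hL.le
      (Filter.Eventually.of_forall fun t ht => ?_) (hcd.intervalIntegrable _ _)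
    have ht' : t ∈ Set.Icc 0 L := ⟨ht.1.le, ht.2⟩
    have hp : 0 < 1 + (s * ψ t) ^ 2 := by positivity
    have e1 : |A t * cos (s ^ 2 * φ t + c) * (1 / (1 + (s * ψ t) ^ 2))| ≤
        K * 1 * (1 / (1 + (s * ψ t) ^ 2)) := by
      rw [abs_mul, abs_mul, abs_of_pos (one_div_pos.2 hp)]
      gcongr
      exacts [hKA t ht', abs_cos_le_one _]
    have e2 : |H₁ t| ≤ K * (K / (1 + (s * ψ t) ^ 2)) +
        K * (K / (1 + (s * ψ t) ^ 2)) := by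
      refine (abs_add_le _ _).trans (add_le_add ?_ ?_)
      · rw [abs_mul, abs_div, abs_of_pos hp]
        gcongr
        exacts [hKA₁ t ht', hK t ht']
      · rw [abs_mul]
        refine mul_le_mul (hKA t ht') ?_ (abs_nonneg _) hK0
        rw [abs_div, abs_mul, abs_of_pos (pow_pos hp 2), div_le_div_iff₀ (by positivity) hp]
        have e3 : |1 - (s * ψ t) ^ 2| ≤ 1 + (s * ψ t) ^ 2 := by
          rw [abs_le]; constructor <;> nlinarith [sq_nonneg (s * ψ t)]
        have := mul_le_mul (hK₁ t ht') e3 (abs_nonneg _) hK0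
        nlinarith
    have e4 : |H₁ t * sin (s ^ 2 * φ t + c)| ≤ |H₁ t| := by
      rw [abs_mul]
      exact mul_le_of_le_one_right (abs_nonneg _) (abs_sin_le_one _)
    rw [Real.norm_eq_abs]
    refine (abs_sub _ _).trans ((add_le_add e1 (e4.trans e2)).trans (le_of_eq ?_))
    ring
  rw [intervalIntegral.integral_const_mul] at hR
  have hB : ∀ t ∈ Set.Icc 0 L, |H t * sin (s ^ 2 * φ t + c)| ≤ K / s := by
    intro t ht
    rw [abs_mul]
    refine (mul_le_of_le_one_right (abs_nonneg _) (abs_sin_le_one _)).trans ?_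
    simp only [H]
    rw [abs_mul, div_eq_mul_one_div K s]
    refine mul_le_mul (hKA t ht) ?_ (abs_nonneg _) hK0
    have hp : 0 < 1 + (s * ψ t) ^ 2 := by positivity
    rw [abs_div, abs_of_pos hp, div_le_div_iff₀ hp hs0, ← abs_of_pos hs0, ← abs_mul,
      abs_of_pos hs0, mul_comm (ψ t), ← sq_abs (s * ψ t)]
    nlinarith [sq_nonneg (|s * ψ t| - 1)]
  have h0 := hB 0 ⟨le_rfl, hL.le⟩
  have h1 := hB L ⟨hL.le, le_rfl⟩
  have h2 := mul_le_mul_of_nonneg_left hI (show 0 ≤ 2 * K ^ 2 + K by positivity)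
  have h3 : (2 * K + (2 * K ^ 2 + K) * ((2 * K + L * K) * (π / 2) / κ + L)) / s =
    K / s + K / s + (2 * K ^ 2 + K) * (((2 * K + L * K) * (π / 2) / κ + L) / s) := by ring
  rw [h3]
  have hR' := hR.trans h2
  rw [abs_le] at h0 h1 hR' ⊢
  constructor <;> linarith

theorem abs_linear_comb_le {p q a b M : ℝ} (h : p ^ 2 + q ^ 2 ≤ 1) (ha : |a| ≤ M) (hb : |b| ≤ M) :
    |p * a + q * b| ≤ 2 * M := by
  have hp : |p| ≤ 1 := abs_le_one_iff_mul_self_le_one.2 (by nlinarith [sq_nonneg q])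
  have hq : |q| ≤ 1 := abs_le_one_iff_mul_self_le_one.2 (by nlinarith [sq_nonneg p])
  have h1 : |p * a| ≤ 1 * M := by
    rw [abs_mul]; exact mul_le_mul hp ha (abs_nonneg _) zero_le_one
  have h2 : |q * b| ≤ 1 * M := by
    rw [abs_mul]; exact mul_le_mul hq hb (abs_nonneg _) zero_le_one
  linarith [abs_add_le (p * a) (q * b)]

theorem exists_abs_le_of_continuous {f : ℝ → ℝ × ℝ} (hf : Continuous f) (L : ℝ) :
    ∃ M : ℝ, 1 ≤ M ∧ ∀ t ∈ Set.Icc 0 L, |(f t).1| ≤ M ∧ |(f t).2| ≤ M := by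
  obtain ⟨M, hM⟩ := (isCompact_Icc (a := (0 : ℝ)) (b := L)).exists_bound_of_continuousOn
    hf.continuousOn
  exact ⟨max M 1, le_max_right _ _, fun t ht =>
    ⟨((norm_fst_le (f t)).trans (hM t ht)).trans (le_max_left _ _),
      ((norm_snd_le (f t)).trans (hM t ht)).trans (le_max_left _ _)⟩⟩

theorem HasDerivAt.fst_coord {f : ℝ → ℝ × ℝ} {f' : ℝ × ℝ} {t : ℝ} (hf : HasDerivAt f f' t) :
    HasDerivAt (fun t => (f t).1) f'.1 t :=
  (ContinuousLinearMap.fst ℝ ℝ ℝ).hasFDerivAt.comp_hasDerivAt t hf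

theorem HasDerivAt.snd_coord {f : ℝ → ℝ × ℝ} {f' : ℝ × ℝ} {t : ℝ} (hf : HasDerivAt f f' t) :
    HasDerivAt (fun t => (f t).2) f'.2 t :=
  (ContinuousLinearMap.snd ℝ ℝ ℝ).hasFDerivAt.comp_hasDerivAt t hf

theorem hasDerivAt_linear_comb {f : ℝ → ℝ × ℝ} {f' : ℝ × ℝ} {t : ℝ} (hf : HasDerivAt f f' t)
    (p q : ℝ) : HasDerivAt (fun t => p * (f t).1 + q * (f t).2) (p * f'.1 + q * f'.2) t :=
  (hf.fst_coord.const_mul p).add (hf.snd_coord.const_mul q)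

theorem le_sq_add_sq_of_orthogonal {a b a' b' u v κ : ℝ} (h : a ^ 2 + b ^ 2 = 1)
    (ho : a * a' + b * b' = 0) (hκ : κ ≤ a' ^ 2 + b' ^ 2) (hu : u ^ 2 + v ^ 2 = 1) :
    κ ≤ (u * a' + v * b') ^ 2 + κ * (u * a + v * b) ^ 2 := by
  have ha' : a' = -(a * b' - b * a') * b := by linear_combination (-a') * h + a * ho
  have hb' : b' = (a * b' - b * a') * a := by linear_combination (-b') * h + b * ho
  generalize a * b' - b * a' = k at ha' hb'
  subst ha' hb'
  have h1 : (u * (-k * b) + v * (k * a)) ^ 2 =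
      ((-k * b) ^ 2 + (k * a) ^ 2) * (1 - (u * a + v * b) ^ 2) := by
    linear_combination (k ^ 2 * (u * a + v * b) ^ 2) * h + (k ^ 2 * (a ^ 2 + b ^ 2)) * hu
  have h5 : 0 ≤ 1 - (u * a + v * b) ^ 2 := by
    have : 1 - (u * a + v * b) ^ 2 = (u * b - v * a) ^ 2 := by
      linear_combination (-(u ^ 2 + v ^ 2)) * h - hu
    rw [this]; positivity
  linarith [mul_le_mul_of_nonneg_right hκ h5]

theorem exists_integral_mul_cos_sq_le {L : ℝ} (hL : 0 < L) {γ : ℝ → ℝ × ℝ}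
    (hγ : ContDiff ℝ (⊤ : ℕ∞) γ)
    (hunit : ∀ t ∈ Set.Icc (0 : ℝ) L, (deriv γ t).1 ^ 2 + (deriv γ t).2 ^ 2 = 1)
    (hcurv : ∀ t ∈ Set.Icc (0 : ℝ) L, deriv (deriv γ) t ≠ 0) :
    ∃ C > 0, ∀ p q p' q' ξ₁ ξ₂ c : ℝ, p ^ 2 + q ^ 2 ≤ 1 → p' ^ 2 + q' ^ 2 ≤ 1 →
      1 ≤ ξ₁ ^ 2 + ξ₂ ^ 2 →
      (∫ t in (0 : ℝ)..L, (p * (deriv γ t).1 + q * (deriv γ t).2) *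
        (p' * (deriv γ t).1 + q' * (deriv γ t).2) *
        cos (2 * π * (ξ₁ * (γ t).1 + ξ₂ * (γ t).2) + c)) ^ 2 ≤ C / √(ξ₁ ^ 2 + ξ₂ ^ 2) := by
  have hγ1 : ContDiff ℝ (⊤ : ℕ∞) (deriv γ) := (contDiff_infty_iff_deriv.1 hγ).2
  have hγ2 : ContDiff ℝ (⊤ : ℕ∞) (deriv (deriv γ)) := (contDiff_infty_iff_deriv.1 hγ1).2
  have hγ3 : ContDiff ℝ (⊤ : ℕ∞) (deriv (deriv (deriv γ))) := (contDiff_infty_iff_deriv.1 hγ2).2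
  have hd0 : ∀ t, HasDerivAt γ (deriv γ t) t := fun t =>
    ((contDiff_infty_iff_deriv.1 hγ).1 t).hasDerivAt
  have hd1 : ∀ t, HasDerivAt (deriv γ) (deriv (deriv γ) t) t := fun t =>
    ((contDiff_infty_iff_deriv.1 hγ1).1 t).hasDerivAt
  have hd2 : ∀ t, HasDerivAt (deriv (deriv γ)) (deriv (deriv (deriv γ)) t) t := fun t =>
    ((contDiff_infty_iff_deriv.1 hγ2).1 t).hasDerivAt
  obtain ⟨M₁, hM₁, hb₁⟩ := exists_abs_le_of_continuous hγ1.continuous L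
  obtain ⟨M₂, hM₂, hb₂⟩ := exists_abs_le_of_continuous hγ2.continuous L
  obtain ⟨M₃, hM₃, hb₃⟩ := exists_abs_le_of_continuous hγ3.continuous L
  have hc1 := hγ1.continuous
  have hc2 := hγ2.continuous
  have hc3 := hγ3.continuous
  obtain ⟨κ, hκ, hκb⟩ : ∃ κ > 0, ∀ t ∈ Set.Icc (0 : ℝ) L,
      κ ≤ (deriv (deriv γ) t).1 ^ 2 + (deriv (deriv γ) t).2 ^ 2 := by
    obtain ⟨t₀, ht₀, hmin⟩ := (isCompact_Icc (a := (0 : ℝ)) (b := L)).exists_isMinOn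
      ⟨0, le_rfl, hL.le⟩ (f := fun t => (deriv (deriv γ) t).1 ^ 2 + (deriv (deriv γ) t).2 ^ 2)
      (by fun_prop)
    refine ⟨_, ?_, fun t ht => hmin ht⟩
    have hne := hcurv t₀ ht₀
    by_contra hle
    refine hne (Prod.ext ?_ ?_) <;> simp only [Prod.fst_zero, Prod.snd_zero] <;>
      nlinarith [sq_nonneg (deriv (deriv γ) t₀).1, sq_nonneg (deriv (deriv γ) t₀).2]
  have horth : ∀ t ∈ Set.Ioo (0 : ℝ) L, (deriv γ t).1 * (deriv (deriv γ) t).1 +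
      (deriv γ t).2 * (deriv (deriv γ) t).2 = 0 := by
    intro t ht
    have h1 : HasDerivAt (fun t => (deriv γ t).1 ^ 2 + (deriv γ t).2 ^ 2)
        (2 * (deriv γ t).1 * (deriv (deriv γ) t).1 +
          2 * (deriv γ t).2 * (deriv (deriv γ) t).2) t := by
      refine (((hd1 t).fst_coord.pow 2).add ((hd1 t).snd_coord.pow 2)).congr_deriv ?_
      simp
    have h2 : (fun t => (deriv γ t).1 ^ 2 + (deriv γ t).2 ^ 2) =ᶠ[nhds t] fun _ => 1 := by
      filter_upwards [Ioo_mem_nhds ht.1 ht.2] with s hs using hunit s ⟨hs.1.le, hs.2.le⟩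
    have h3 := h1.unique ((hasDerivAt_const t (1 : ℝ)).congr_of_eventuallyEq h2)
    linarith
  set M := max M₁ (max M₂ M₃) with hMdef
  have hM1 : 1 ≤ M := hM₁.trans (le_max_left _ _)
  have hbd : ∀ t ∈ Set.Icc 0 L, (|(deriv γ t).1| ≤ M ∧ |(deriv γ t).2| ≤ M) ∧
      (|(deriv (deriv γ) t).1| ≤ M ∧ |(deriv (deriv γ) t).2| ≤ M) ∧
      (|(deriv (deriv (deriv γ)) t).1| ≤ M ∧ |(deriv (deriv (deriv γ)) t).2| ≤ M) := by
    intro t ht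
    have e1 : M₁ ≤ M := le_max_left _ _
    have e2 : M₂ ≤ M := (le_max_left _ _).trans (le_max_right _ _)
    have e3 : M₃ ≤ M := (le_max_right _ _).trans (le_max_right _ _)
    exact ⟨⟨(hb₁ t ht).1.trans e1, (hb₁ t ht).2.trans e1⟩,
      ⟨(hb₂ t ht).1.trans e2, (hb₂ t ht).2.trans e2⟩,
      ⟨(hb₃ t ht).1.trans e3, (hb₃ t ht).2.trans e3⟩⟩
  set K := 8 * M ^ 2 with hKdef
  set C₀ := 2 * K + (2 * K ^ 2 + K) * ((2 * K + L * K) * (π / 2) / κ + L) with hC₀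
  have hC₀pos : 0 < C₀ := by positivity
  refine ⟨C₀ ^ 2, by positivity, fun p q p' q' ξ₁ ξ₂ c hpq hpq' hξ => ?_⟩
  set r := √(ξ₁ ^ 2 + ξ₂ ^ 2) with hr
  have hr1 : 1 ≤ r := by rw [hr]; exact Real.one_le_sqrt.2 hξ
  have hr0 : 0 < r := by linarith
  have hrsq : r ^ 2 = ξ₁ ^ 2 + ξ₂ ^ 2 := Real.sq_sqrt (by positivity)
  have hu : (ξ₁ / r) ^ 2 + (ξ₂ / r) ^ 2 = 1 := by
    rw [div_pow, div_pow, ← add_div, ← hrsq, div_self (by positivity)]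
  have hs1 : 1 ≤ 2 * π * r := by nlinarith [Real.pi_gt_three]
  have hs : 1 ≤ √(2 * π * r) := Real.one_le_sqrt.2 hs1
  have hssq : √(2 * π * r) ^ 2 = 2 * π * r := Real.sq_sqrt (by linarith)
  have hKM : 2 * M ≤ K := by nlinarith
  have hAd : ∀ t, HasDerivAt (fun t => (p * (deriv γ t).1 + q * (deriv γ t).2) *
      (p' * (deriv γ t).1 + q' * (deriv γ t).2))
      ((p * (deriv (deriv γ) t).1 + q * (deriv (deriv γ) t).2) *
      (p' * (deriv γ t).1 + q' * (deriv γ t).2) + (p * (deriv γ t).1 + q * (deriv γ t).2) *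
      (p' * (deriv (deriv γ) t).1 + q' * (deriv (deriv γ) t).2)) t := fun t =>
    (hasDerivAt_linear_comb (hd1 t) p q).mul (hasDerivAt_linear_comb (hd1 t) p' q')
  have key := abs_integral_mul_cos_le hL hκ (K := K) (s := √(2 * π * r))
    (fun t => hasDerivAt_linear_comb (hd0 t) (ξ₁ / r) (ξ₂ / r))
    (fun t => hasDerivAt_linear_comb (hd1 t) (ξ₁ / r) (ξ₂ / r))
    (fun t => hasDerivAt_linear_comb (hd2 t) (ξ₁ / r) (ξ₂ / r))
    (by fun_prop) hAd (by fun_prop)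
    (fun t ht => (abs_linear_comb_le hu.le (hbd t ht).1.1 (hbd t ht).1.2).trans hKM)
    (fun t ht => (abs_linear_comb_le hu.le (hbd t ht).2.1.1 (hbd t ht).2.1.2).trans hKM)
    (fun t ht => (abs_linear_comb_le hu.le (hbd t ht).2.2.1 (hbd t ht).2.2.2).trans hKM)
    (fun t ht => by
      rw [abs_mul]
      have := mul_le_mul (abs_linear_comb_le hpq (hbd t ht).1.1 (hbd t ht).1.2)
        (abs_linear_comb_le hpq' (hbd t ht).1.1 (hbd t ht).1.2) (abs_nonneg _) (by linarith)
      rw [hKdef]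
      linarith [sq_nonneg M])
    (fun t ht => by
      refine (abs_add_le _ _).trans ?_
      rw [abs_mul, abs_mul]
      have e1 := mul_le_mul (abs_linear_comb_le hpq (hbd t ht).2.1.1 (hbd t ht).2.1.2)
        (abs_linear_comb_le hpq' (hbd t ht).1.1 (hbd t ht).1.2) (abs_nonneg _) (by linarith)
      have e2 := mul_le_mul (abs_linear_comb_le hpq (hbd t ht).1.1 (hbd t ht).1.2)
        (abs_linear_comb_le hpq' (hbd t ht).2.1.1 (hbd t ht).2.1.2) (abs_nonneg _) (by linarith)
      rw [hKdef]
      linarith [sq_nonneg M])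
    (fun t ht => by
      have ht' : t ∈ Set.Icc (0 : ℝ) L := ⟨ht.1.le, ht.2.le⟩
      exact le_sq_add_sq_of_orthogonal (hunit t ht') (horth t ht) (hκb t ht') hu)
    hs c
  have hint : ∀ t, √(2 * π * r) ^ 2 * (ξ₁ / r * (γ t).1 + ξ₂ / r * (γ t).2) + c =
      2 * π * (ξ₁ * (γ t).1 + ξ₂ * (γ t).2) + c := by
    intro t
    rw [hssq]
    field_simp
  simp only [hint] at key
  refine (sq_le_sq.2 (key.trans (le_abs_self _))).trans ?_
  rw [div_pow, hssq]
  exact div_le_div_of_nonneg_left (by positivity) hr0 (by nlinarith [Real.pi_gt_three])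

theorem mem_latticeSet {m : ℕ} {μ : ℤ × ℤ} :
    μ ∈ latticeSet m ↔ μ.1 ^ 2 + μ.2 ^ 2 = (m : ℤ) := by
  simp only [latticeSet, Finset.mem_filter, Finset.mem_product, Finset.mem_Icc, and_iff_right_iff_imp]
  intro h
  refine ⟨⟨?_, ?_⟩, ?_, ?_⟩ <;> nlinarith [Int.le_self_sq μ.1, Int.le_self_sq (-μ.1),
    Int.le_self_sq μ.2, Int.le_self_sq (-μ.2), sq_nonneg μ.1, sq_nonneg μ.2]

/-- The Gaussian integers of norm `m`. -/
def gaussianSphere (m : ℕ) : Finset GaussianInt :=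
  (latticeSet m).image fun μ => ⟨μ.1, μ.2⟩

theorem GaussianInt.norm_eq_sq_add_sq (z : GaussianInt) : z.norm = z.re ^ 2 + z.im ^ 2 := by
  rw [Zsqrtd.norm_def]; ring

theorem mem_gaussianSphere {m : ℕ} {z : GaussianInt} : z ∈ gaussianSphere m ↔ z.norm = m := by
  simp only [gaussianSphere, Finset.mem_image, mem_latticeSet, GaussianInt.norm_eq_sq_add_sq]
  exact ⟨by rintro ⟨μ, h, rfl⟩; exact h, fun h => ⟨(z.re, z.im), h, rfl⟩⟩

theorem gaussian_mk_injective : Function.Injective fun μ : ℤ × ℤ => (⟨μ.1, μ.2⟩ : GaussianInt) :=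
  fun _ _ h => Prod.ext (congrArg Zsqrtd.re h) (congrArg Zsqrtd.im h)

theorem card_gaussianSphere (m : ℕ) : (gaussianSphere m).card = latN m :=
  Finset.card_image_of_injective _ gaussian_mk_injective

/-- The Gaussian integers whose norm divides `m`. -/
def gaussianDivisors (m : ℕ) : Finset GaussianInt :=
  m.divisors.biUnion gaussianSphere

theorem mem_gaussianDivisors {m : ℕ} (hm : m ≠ 0) {z : GaussianInt} :
    z ∈ gaussianDivisors m ↔ z.norm ∣ (m : ℤ) := by
  simp only [gaussianDivisors, Finset.mem_biUnion, Nat.mem_divisors, mem_gaussianSphere]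
  constructor
  · rintro ⟨d, ⟨hd, -⟩, h⟩
    rw [h]; exact_mod_cast hd
  · intro h
    have h0 := GaussianInt.abs_natCast_norm z
    refine ⟨z.norm.natAbs, ⟨?_, hm⟩, h0.symm⟩
    rwa [← h0, Int.natCast_dvd_natCast] at h

/-- The inverse of the absolute value of a Gaussian integer. -/
def invAbs (z : GaussianInt) : ℝ := (√(z.norm : ℝ))⁻¹

theorem invAbs_nonneg (z : GaussianInt) : 0 ≤ invAbs z := by unfold invAbs; positivity

theorem invAbs_mul (z w : GaussianInt) : invAbs (z * w) = invAbs z * invAbs w := by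
  unfold invAbs
  rw [Zsqrtd.norm_mul, Int.cast_mul, Real.sqrt_mul (by exact_mod_cast GaussianInt.norm_nonneg z),
    mul_inv]

theorem invAbs_zero : invAbs 0 = 0 := by simp [invAbs]

theorem invAbs_pow (z : GaussianInt) (n : ℕ) : invAbs (z ^ n) = invAbs z ^ n := by
  induction n with
  | zero => simp [invAbs]
  | succ n ih => rw [pow_succ, invAbs_mul, ih, pow_succ]

theorem invAbs_natCast (k : ℕ) : invAbs k = (k : ℝ)⁻¹ := by
  simp [invAbs, Zsqrtd.norm_natCast]

/-- The sum of `1 / |z|` over the Gaussian integers `z` whose norm divides `m`. -/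
def sumInvAbs (m : ℕ) : ℝ := ∑ z ∈ gaussianDivisors m, invAbs z

theorem sumInvAbs_nonneg (m : ℕ) : 0 ≤ sumInvAbs m :=
  Finset.sum_nonneg fun z _ => invAbs_nonneg z

theorem GaussianInt.prime_of_norm_prime {ϖ : GaussianInt} {p : ℕ} (hp : p.Prime)
    (h : ϖ.norm = p) : Prime ϖ := by
  refine Irreducible.prime ⟨fun hu => ?_, fun {a b} hab => ?_⟩
  · rw [← Zsqrtd.norm_eq_one_iff, h, Int.natAbs_natCast] at hu
    exact hp.one_lt.ne' hu
  · have h1 : a.norm.natAbs * b.norm.natAbs = p := by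
      rw [← Int.natAbs_mul, ← Zsqrtd.norm_mul, ← hab, h, Int.natAbs_natCast]
    rw [← Zsqrtd.norm_eq_one_iff, ← Zsqrtd.norm_eq_one_iff]
    simpa only [Nat.isUnit_iff] using Irreducible.isUnit_or_isUnit hp h1.symm

theorem GaussianInt.exists_decomposition {ϖ : GaussianInt} {p : ℕ} (hp : p.Prime)
    (hϖ : ϖ.norm = p) (m : ℕ) (α : ℕ) (z : GaussianInt) (hz : z.norm ∣ ((p ^ α * m : ℕ) : ℤ)) :
    ∃ i ≤ α, ∃ j ≤ α, ∃ w : GaussianInt, w.norm ∣ (m : ℤ) ∧ z = ϖ ^ i * star ϖ ^ j * w := by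
  have hprime := GaussianInt.prime_of_norm_prime hp hϖ
  have hp0 : (p : ℤ) ≠ 0 := by exact_mod_cast hp.ne_zero
  induction α generalizing z with
  | zero => exact ⟨0, le_rfl, 0, le_rfl, z, by simpa using hz, by simp⟩
  | succ α ih =>
    have step : ∀ w : GaussianInt, (p : ℤ) * w.norm ∣ ((p ^ (α + 1) * m : ℕ) : ℤ) →
        w.norm ∣ ((p ^ α * m : ℕ) : ℤ) := by
      intro w h
      have : ((p ^ (α + 1) * m : ℕ) : ℤ) = p * ((p ^ α * m : ℕ) : ℤ) := by push_cast; ring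
      rw [this] at h
      exact Int.dvd_of_mul_dvd_mul_left hp0 h
    by_cases hd : (p : ℤ) ∣ z.norm
    · have h1 : ϖ ∣ z * star z := by
        rw [← Zsqrtd.norm_eq_mul_conj]
        have h2 : ϖ ∣ ((p : ℤ) : GaussianInt) := by
          rw [← hϖ, Zsqrtd.norm_eq_mul_conj]; exact dvd_mul_right _ _
        exact h2.trans (Int.cast_dvd_cast _ _ hd)
      rcases hprime.dvd_or_dvd h1 with ⟨w, rfl⟩ | ⟨w, hw⟩
      · rw [Zsqrtd.norm_mul, hϖ] at hz
        obtain ⟨i, hi, j, hj, u, hu, rfl⟩ := ih w (step w hz)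
        exact ⟨i + 1, by lia, j, by lia, u, hu, by ring⟩
      · have hz' : z = star ϖ * star w := by
          rw [← star_mul', ← hw, star_star]
        rw [hz', Zsqrtd.norm_mul, Zsqrtd.norm_conj, hϖ] at hz
        obtain ⟨i, hi, j, hj, u, hu, hu'⟩ := ih _ (step _ hz)
        exact ⟨i, by lia, j + 1, by lia, u, hu, by rw [hz', hu']; ring⟩
    · refine ⟨0, by lia, 0, by lia, z, ?_, by simp⟩
      have hcop : IsCoprime z.norm ((p : ℤ) ^ (α + 1)) :=
        (((Nat.prime_iff_prime_int.1 hp).coprime_iff_not_dvd.2 hd).symm).pow_right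
      push_cast at hz
      exact hcop.dvd_of_dvd_mul_left hz

theorem sum_range_pow_le_inv {x : ℝ} (hx0 : 0 ≤ x) (hx1 : x < 1) (n : ℕ) :
    ∑ i ∈ Finset.range n, x ^ i ≤ (1 - x)⁻¹ := by
  rw [← tsum_geometric_of_lt_one hx0 hx1]
  exact (summable_geometric_of_lt_one hx0 hx1).sum_le_tsum _ fun i _ => pow_nonneg hx0 i

theorem GaussianInt.exists_norm_eq_prime {p : ℕ} (hp : p.Prime) (hp4 : p % 4 ≠ 3) :
    ∃ ϖ : GaussianInt, ϖ.norm = p := by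
  have := Fact.mk hp
  obtain ⟨a, b, hab⟩ := Nat.Prime.sq_add_sq hp4
  refine ⟨⟨a, b⟩, ?_⟩
  rw [GaussianInt.norm_eq_sq_add_sq]
  show (a : ℤ) ^ 2 + (b : ℤ) ^ 2 = p
  exact_mod_cast hab

theorem sumInvAbs_prime_pow_mul_le {p : ℕ} (hp : p.Prime) (hp4 : p % 4 ≠ 3) {m : ℕ} (hm : m ≠ 0)
    (α : ℕ) : sumInvAbs (p ^ α * m) ≤ ((1 - (√(p : ℝ))⁻¹)⁻¹) ^ 2 * sumInvAbs m := by
  obtain ⟨ϖ, hϖ⟩ := GaussianInt.exists_norm_eq_prime hp hp4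
  have hinv : invAbs ϖ = (√(p : ℝ))⁻¹ := by simp [invAbs, hϖ]
  have hinv' : invAbs (star ϖ) = (√(p : ℝ))⁻¹ := by simp [invAbs, hϖ, Zsqrtd.norm_conj]
  set x := (√(p : ℝ))⁻¹ with hx
  have hx0 : 0 ≤ x := by positivity
  have hx1 : x < 1 := by
    refine inv_lt_one_of_one_lt₀ ?_
    rw [Real.lt_sqrt zero_le_one]
    simpa using hp.one_lt
  have hsub : gaussianDivisors (p ^ α * m) ⊆
      ((Finset.range (α + 1) ×ˢ Finset.range (α + 1)) ×ˢ gaussianDivisors m).image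
        fun t => ϖ ^ t.1.1 * star ϖ ^ t.1.2 * t.2 := by
    intro z hz
    rw [mem_gaussianDivisors (by have := hp.ne_zero; positivity)] at hz
    obtain ⟨i, hi, j, hj, w, hw, rfl⟩ := GaussianInt.exists_decomposition hp hϖ m α z hz
    refine Finset.mem_image.2 ⟨((i, j), w), ?_, rfl⟩
    simp only [Finset.mem_product, Finset.mem_range, mem_gaussianDivisors hm]
    exact ⟨⟨by lia, by lia⟩, hw⟩
  calc sumInvAbs (p ^ α * m)
      ≤ ∑ z ∈ ((Finset.range (α + 1) ×ˢ Finset.range (α + 1)) ×ˢ gaussianDivisors m).image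
        (fun t => ϖ ^ t.1.1 * star ϖ ^ t.1.2 * t.2), invAbs z :=
        Finset.sum_le_sum_of_subset_of_nonneg hsub fun z _ _ => invAbs_nonneg z
    _ ≤ ∑ t ∈ (Finset.range (α + 1) ×ˢ Finset.range (α + 1)) ×ˢ gaussianDivisors m,
        invAbs (ϖ ^ t.1.1 * star ϖ ^ t.1.2 * t.2) :=
        Finset.sum_image_le_of_nonneg fun z _ => invAbs_nonneg z
    _ = (∑ i ∈ Finset.range (α + 1), x ^ i) ^ 2 * sumInvAbs m := by
        simp only [invAbs_mul, invAbs_pow, hinv, hinv']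
        rw [sq, Finset.sum_mul_sum, ← Finset.sum_product', sumInvAbs, Finset.sum_mul_sum,
          ← Finset.sum_product']
    _ ≤ ((1 - x)⁻¹) ^ 2 * sumInvAbs m := by
        gcongr
        · exact sumInvAbs_nonneg m
        · exact sum_range_pow_le_inv hx0 hx1 _

theorem GaussianInt.norm_pow (z : GaussianInt) (n : ℕ) : (z ^ n).norm = z.norm ^ n :=
  map_pow (Zsqrtd.normMonoidHom (d := -1)) z n

theorem latN_le_latN_prime_pow_mul {p : ℕ} (hp : p.Prime) (hp4 : p % 4 ≠ 3) (m α : ℕ) :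
    latN m ≤ latN (p ^ α * m) := by
  obtain ⟨ϖ, hϖ⟩ := GaussianInt.exists_norm_eq_prime hp hp4
  have hϖ0 : ϖ ≠ 0 := (GaussianInt.prime_of_norm_prime hp hϖ).ne_zero
  rw [← card_gaussianSphere, ← card_gaussianSphere]
  refine Finset.card_le_card_of_injOn (fun w => ϖ ^ α * w) (fun w hw => ?_)
    fun w _ w' _ h => mul_left_cancel₀ (pow_ne_zero _ hϖ0) h
  rw [Finset.mem_coe, mem_gaussianSphere] at hw ⊢
  rw [Zsqrtd.norm_mul, hw, GaussianInt.norm_pow, hϖ]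
  push_cast; rfl

theorem GaussianInt.not_dvd_star {ϖ : GaussianInt} {p : ℕ} (hp : p.Prime) (hp2 : p ≠ 2)
    (hϖ : ϖ.norm = p) : ¬ ϖ ∣ star ϖ := by
  intro h
  have hpZ := Nat.prime_iff_prime_int.1 hp
  rw [GaussianInt.norm_eq_sq_add_sq] at hϖ
  have h2 : ϖ ∣ ((2 * ϖ.re : ℤ) : GaussianInt) := by
    have : ((2 * ϖ.re : ℤ) : GaussianInt) = ϖ + star ϖ := by
      ext <;> simp; ring
    rw [this]; exact dvd_add dvd_rfl h
  have h3 : (p : ℤ) ∣ 2 * ϖ.re * (2 * ϖ.re) := by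
    rw [← Zsqrtd.norm_intCast (d := -1), ← hϖ, ← GaussianInt.norm_eq_sq_add_sq]
    obtain ⟨w, hw⟩ := h2
    rw [hw, Zsqrtd.norm_mul]; exact dvd_mul_right _ _
  have h4 : ¬ (p : ℤ) ∣ 2 := by
    intro h
    exact hp2 ((Nat.prime_dvd_prime_iff_eq hp Nat.prime_two).1 (by exact_mod_cast h))
  have h5 : (p : ℤ) ∣ ϖ.re := by
    rcases hpZ.dvd_or_dvd h3 with h | h <;> exact (hpZ.dvd_or_dvd h).resolve_left h4
  have h6 : (p : ℤ) ∣ ϖ.im := by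
    refine hpZ.dvd_of_dvd_pow (n := 2) ?_
    rw [← (dvd_add_right (h5.trans (dvd_pow_self _ two_ne_zero))), hϖ]
  have h7 : (p : ℤ) ^ 2 ∣ ϖ.re ^ 2 + ϖ.im ^ 2 :=
    dvd_add (pow_dvd_pow_of_dvd h5 2) (pow_dvd_pow_of_dvd h6 2)
  rw [hϖ, sq] at h7
  exact hpZ.not_dvd_one (Int.dvd_of_mul_dvd_mul_left hpZ.ne_zero (h7.trans (by simp)))

theorem two_mul_latN_le {p : ℕ} (hp : p.Prime) (hp4 : p % 4 ≠ 3) (hp2 : p ≠ 2) {m α : ℕ}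
    (hα : α ≠ 0) (hm : ¬ p ∣ m) : 2 * latN m ≤ latN (p ^ α * m) := by
  obtain ⟨ϖ, hϖ⟩ := GaussianInt.exists_norm_eq_prime hp hp4
  have hprime := GaussianInt.prime_of_norm_prime hp hϖ
  have hstar0 : star ϖ ≠ 0 := by simpa using hprime.ne_zero
  have hnp : ∀ (ρ : GaussianInt), ρ.norm = p → ∀ w ∈ gaussianSphere m,
      ρ ^ α * w ∈ gaussianSphere (p ^ α * m) := by
    intro ρ hρ w hw
    rw [mem_gaussianSphere] at hw ⊢
    rw [Zsqrtd.norm_mul, hw, GaussianInt.norm_pow, hρ]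
    push_cast; rfl
  have hdisj : Disjoint ((gaussianSphere m).image fun w => ϖ ^ α * w)
      ((gaussianSphere m).image fun w => star ϖ ^ α * w) := by
    rw [Finset.disjoint_left]
    intro z hz hz'
    obtain ⟨w, hw, rfl⟩ := Finset.mem_image.1 hz
    obtain ⟨w', hw', h⟩ := Finset.mem_image.1 hz'
    have h1 : ϖ ∣ star ϖ ^ α * w' := by
      rw [h]; exact (dvd_pow_self _ hα).trans (dvd_mul_right _ _)
    rcases hprime.dvd_or_dvd h1 with h2 | ⟨u, rfl⟩
    · exact GaussianInt.not_dvd_star hp hp2 hϖ (hprime.dvd_of_dvd_pow h2)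
    · rw [mem_gaussianSphere, Zsqrtd.norm_mul, hϖ] at hw'
      exact hm (Int.natCast_dvd_natCast.1 ⟨_, hw'.symm⟩)
  have hcard := Finset.card_union_of_disjoint hdisj
  rw [Finset.card_image_of_injective _ (mul_right_injective₀ (pow_ne_zero _ hprime.ne_zero)),
    Finset.card_image_of_injective _ (mul_right_injective₀ (pow_ne_zero _ hstar0)),
    card_gaussianSphere] at hcard
  rw [two_mul, ← hcard, ← card_gaussianSphere]
  refine Finset.card_le_card (Finset.union_subset ?_ ?_)
  · exact Finset.image_subset_iff.2 (hnp ϖ hϖ)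
  · exact Finset.image_subset_iff.2 (hnp _ (by rw [Zsqrtd.norm_conj, hϖ]))

theorem exists_inv_one_sub_inv_sqrt_le {c : ℝ} (hc : 1 < c) :
    ∃ P : ℕ, 2 < P ∧ ∀ p : ℕ, P ≤ p → ((1 - (√(p : ℝ))⁻¹)⁻¹) ^ 2 ≤ c := by
  have h : Filter.Tendsto (fun p : ℕ => ((1 - (√(p : ℝ))⁻¹)⁻¹) ^ 2) Filter.atTop (nhds 1) := by
    have h1 : Filter.Tendsto (fun p : ℕ => (√(p : ℝ))⁻¹) Filter.atTop (nhds 0) :=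
      (Real.tendsto_sqrt_atTop.comp tendsto_natCast_atTop_atTop).inv_tendsto_atTop
    simpa using (((tendsto_const_nhds (x := (1 : ℝ))).sub h1).inv₀ (by simp)).pow 2
  obtain ⟨P, hP⟩ := Filter.eventually_atTop.1 (h.eventually_le_const hc)
  exact ⟨max P 3, by simp, fun p hp => hP p (le_of_max_le_left hp)⟩

theorem one_le_latN_one : 1 ≤ latN 1 := by
  refine Finset.card_pos.2 ⟨(1, 0), ?_⟩
  simp [mem_latticeSet]

theorem inv_one_sub_inv_sqrt_sq_le {p : ℕ} (hp : 2 ≤ p) :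
    ((1 - (√(p : ℝ))⁻¹)⁻¹) ^ 2 ≤ ((1 - (√(2 : ℝ))⁻¹)⁻¹) ^ 2 := by
  have h2 : (√(2 : ℝ))⁻¹ < 1 := inv_lt_one_of_one_lt₀ (Real.lt_sqrt zero_le_one |>.2 (by norm_num))
  have h3 : (√(p : ℝ))⁻¹ ≤ (√(2 : ℝ))⁻¹ := by
    gcongr
    exact_mod_cast hp
  have h4 : 0 < 1 - (√(2 : ℝ))⁻¹ := by linarith
  have h5 : 0 < 1 - (√(p : ℝ))⁻¹ := by linarith
  gcongr

theorem one_le_inv_one_sub_inv_sqrt_two_sq : 1 ≤ ((1 - (√(2 : ℝ))⁻¹)⁻¹) ^ 2 := by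
  have h2 : (√(2 : ℝ))⁻¹ < 1 := inv_lt_one_of_one_lt₀ (Real.lt_sqrt zero_le_one |>.2 (by norm_num))
  have h0 : 0 < (√(2 : ℝ))⁻¹ := by positivity
  exact one_le_pow₀ ((one_le_inv₀ (by linarith)).2 (by linarith))

theorem exists_sumInvAbs_le {ε : ℝ} (hε : 0 < ε) : ∃ C > 0, ∀ m : ℕ, m ≠ 0 →
    (∀ p : ℕ, p.Prime → p ∣ m → p % 4 ≠ 3) → sumInvAbs m ≤ C * (latN m : ℝ) ^ ε := by
  obtain ⟨P, hP2, hP⟩ := exists_inv_one_sub_inv_sqrt_le (Real.one_lt_rpow one_lt_two hε)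
  set c := ((1 - (√(2 : ℝ))⁻¹)⁻¹) ^ 2 with hcdef
  have hc : 1 ≤ c := one_le_inv_one_sub_inv_sqrt_two_sq
  have hc0 : 0 ≤ c := by linarith
  have key : ∀ m : ℕ, m ≠ 0 → (∀ p : ℕ, p.Prime → p ∣ m → p % 4 ≠ 3) →
      sumInvAbs m ≤ sumInvAbs 1 * c ^ (m.primeFactors.filter (· < P)).card *
        (latN m : ℝ) ^ ε := by
    intro m
    induction m using Nat.strong_induction_on with
    | _ m ih =>
    intro hm hgood
    by_cases hm1 : m = 1
    · subst hm1
      have h1 : (1 : ℝ) ≤ latN 1 := by exact_mod_cast one_le_latN_one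
      simpa using le_mul_of_one_le_right (sumInvAbs_nonneg 1) (Real.one_le_rpow h1 hε.le)
    obtain ⟨p, hp, hpm⟩ := Nat.exists_prime_and_dvd hm1
    obtain ⟨α, n, hpn, rfl⟩ := Nat.exists_eq_pow_mul_and_not_dvd hm p hp.ne_one
    have hα : α ≠ 0 := by
      rintro rfl
      simp [hpn] at hpm
    have hn : n ≠ 0 := by rintro rfl; simp at hm
    have hp4 := hgood p hp hpm
    have hlt : n < p ^ α * n :=
      lt_mul_of_one_lt_left (Nat.pos_of_ne_zero hn) (Nat.one_lt_pow hα hp.one_lt)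
    have hI := ih n hlt hn fun q hq hqn => hgood q hq (hqn.mul_left _)
    have hS := sumInvAbs_prime_pow_mul_le hp hp4 hn α
    have hpf : (p ^ α * n).primeFactors = insert p n.primeFactors := by
      rw [Nat.primeFactors_mul (pow_ne_zero _ hp.ne_zero) hn, Nat.primeFactors_prime_pow hα hp]
      rfl
    have hpnot : p ∉ n.primeFactors := fun h => hpn (Nat.dvd_of_mem_primeFactors h)
    have hS1 := sumInvAbs_nonneg 1
    set k := (n.primeFactors.filter (· < P)).card with hk
    by_cases hpP : p < P
    · have hcard : ((p ^ α * n).primeFactors.filter (· < P)).card = k + 1 := by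
        rw [hpf, Finset.filter_insert, if_pos hpP, Finset.card_insert_of_notMem (by simp [hpn])]
      rw [hcard]
      have hN : (latN n : ℝ) ^ ε ≤ (latN (p ^ α * n) : ℝ) ^ ε := by
        gcongr
        exact latN_le_latN_prime_pow_mul hp hp4 n α
      calc sumInvAbs (p ^ α * n) ≤ _ := hS
        _ ≤ c * (sumInvAbs 1 * c ^ k * (latN n : ℝ) ^ ε) :=
          mul_le_mul (inv_one_sub_inv_sqrt_sq_le hp.two_le) hI (sumInvAbs_nonneg n) hc0
        _ ≤ c * (sumInvAbs 1 * c ^ k * (latN (p ^ α * n) : ℝ) ^ ε) := by gcongr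
        _ = _ := by ring
    · have hcard : ((p ^ α * n).primeFactors.filter (· < P)).card = k := by
        rw [hpf, Finset.filter_insert, if_neg hpP]
      rw [hcard]
      have hN : (2 : ℝ) ^ ε * (latN n : ℝ) ^ ε ≤ (latN (p ^ α * n) : ℝ) ^ ε := by
        rw [← Real.mul_rpow two_pos.le (Nat.cast_nonneg _)]
        gcongr
        exact_mod_cast two_mul_latN_le hp hp4 (by lia) hα hpn
      calc sumInvAbs (p ^ α * n) ≤ _ := hS
        _ ≤ 2 ^ ε * (sumInvAbs 1 * c ^ k * (latN n : ℝ) ^ ε) :=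
          mul_le_mul (hP p (not_lt.1 hpP)) hI (sumInvAbs_nonneg n) (by positivity)
        _ = sumInvAbs 1 * c ^ k * (2 ^ ε * (latN n : ℝ) ^ ε) := by ring
        _ ≤ _ := by gcongr
  refine ⟨sumInvAbs 1 * c ^ P + 1, by have := sumInvAbs_nonneg 1; positivity, fun m hm hg => ?_⟩
  refine (key m hm hg).trans ?_
  have hcard : (m.primeFactors.filter (· < P)).card ≤ P := by
    refine (Finset.card_le_card (t := Finset.range P) fun q hq => ?_).trans_eq (Finset.card_range P)
    exact Finset.mem_range.2 (Finset.mem_filter.1 hq).2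
  have := sumInvAbs_nonneg 1
  have h2 : sumInvAbs 1 * c ^ (m.primeFactors.filter (· < P)).card ≤ sumInvAbs 1 * c ^ P + 1 := by
    have : sumInvAbs 1 * c ^ (m.primeFactors.filter (· < P)).card ≤ sumInvAbs 1 * c ^ P := by
      gcongr
    linarith
  gcongr

theorem GaussianInt.exists_natCast_mul_of_norm_eq {m : ℕ} {z z' : GaussianInt} (hz : z.norm = m)
    (hz' : z'.norm = m) (hne : z ≠ z') :
    ∃ t : ℕ × GaussianInt, 0 < t.1 ∧ t.2.norm ∣ ((4 * m : ℕ) : ℤ) ∧ z - z' = t.1 * t.2 := by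
  obtain ⟨x, y⟩ := z
  obtain ⟨x', y'⟩ := z'
  have hpos : 0 < Int.gcd (x - x') (y - y') := by
    rw [Int.gcd_pos_iff]
    by_contra! h
    exact hne (by ext <;> simp <;> lia)
  obtain ⟨p, q, hpq, hp, hq⟩ := Int.exists_gcd_one hpos
  set k := Int.gcd (x - x') (y - y') with hk
  have hk0 : (k : ℤ) ≠ 0 := by exact_mod_cast hpos.ne'
  refine ⟨(k, ⟨p, q⟩), hpos, ?_, ?_⟩
  · rw [GaussianInt.norm_eq_sq_add_sq] at hz hz' ⊢
    simp only at hz hz' ⊢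
    have h1 : 2 * (x * p + y * q) = k * (p ^ 2 + q ^ 2) := by
      refine mul_left_cancel₀ hk0 ?_
      have hx' : x' = x - p * k := by lia
      have hy' : y' = y - q * k := by lia
      rw [hx', hy'] at hz'
      linear_combination hz - hz'
    have hcop : IsCoprime (p ^ 2 + q ^ 2) (p ^ 2) := by
      have h2 : IsCoprime (q ^ 2) (p ^ 2) := (Int.isCoprime_iff_gcd_eq_one.2 hpq).symm.pow
      have h3 := IsCoprime.add_mul_left_left h2 1
      rwa [mul_one, add_comm] at h3
    refine hcop.dvd_of_dvd_mul_left ⟨2 * k * (x * p - y * q) + 4 * y ^ 2, ?_⟩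
    push_cast
    rw [← hz]
    linear_combination (2 * (x * p - y * q)) * h1
  · ext <;> simp <;> lia

theorem GaussianInt.eq_of_sub_eq_of_norm_eq {m : ℤ} {z z' u u' : GaussianInt} (hz : z.norm = m)
    (hz' : z'.norm = m) (hu : u.norm = m) (hu' : u'.norm = m) (hne : z ≠ z')
    (h : z - z' = u - u')
    (hs : 0 ≤ z.re * (z - z').im - z.im * (z - z').re ↔
      0 ≤ u.re * (u - u').im - u.im * (u - u').re) : z = u ∧ z' = u' := by
  have hv0 : z - z' ≠ 0 := sub_ne_zero.2 hne
  have hz'' : z' = z - (z - z') := by ring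
  have hu'' : u' = u - (z - z') := by rw [h]; ring
  rw [← h] at hs
  rw [hz''] at hz'
  rw [hu''] at hu'
  suffices z = u from ⟨this, by rw [hz'', hu'', this]⟩
  generalize z - z' = v at *
  have hv : 0 < v.norm := GaussianInt.norm_pos.2 hv0
  rw [GaussianInt.norm_eq_sq_add_sq] at hz hz' hu hu' hv
  simp only [Zsqrtd.re_sub, Zsqrtd.im_sub] at hz' hu'
  obtain ⟨x, y⟩ := z
  obtain ⟨a, b⟩ := u
  obtain ⟨p, q⟩ := v
  simp only at *
  have hd : x * p + y * q = a * p + b * q := by linarith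
  have hc : (x * q - y * p) ^ 2 = (a * q - b * p) ^ 2 := by
    linear_combination (p ^ 2 + q ^ 2) * (hz - hu) - (x * p + y * q + (a * p + b * q)) * hd
  have hcr : x * q - y * p = a * q - b * p := by
    rcases sq_eq_sq_iff_eq_or_eq_neg.1 hc with h1 | h1
    · exact h1
    · by_cases h0 : 0 ≤ x * q - y * p
      · have := hs.1 h0; lia
      · have := mt hs.2 h0; lia
  have hx : (p ^ 2 + q ^ 2) * x = (p ^ 2 + q ^ 2) * a := by
    linear_combination p * hd + q * hcr
  have hy : (p ^ 2 + q ^ 2) * y = (p ^ 2 + q ^ 2) * b := by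
    linear_combination q * hd - p * hcr
  ext
  · exact mul_left_cancel₀ hv.ne' hx
  · exact mul_left_cancel₀ hv.ne' hy

/-- The sum of `1 / |z - z'|` over the pairs of distinct Gaussian integers of norm `m`. -/
def sumInvDist (m : ℕ) : ℝ :=
  ∑ z ∈ gaussianSphere m, ∑ z' ∈ gaussianSphere m, invAbs (z - z')

theorem sum_invAbs_sub_near_le {m : ℕ} (hm : m ≠ 0) (K : ℕ) :
    ∑ t ∈ (gaussianSphere m ×ˢ gaussianSphere m).filter
      (fun t => t.1 ≠ t.2 ∧ (t.1 - t.2).norm ≤ (K : ℤ) ^ 2), invAbs (t.1 - t.2) ≤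
    2 * (1 + Real.log K) * sumInvAbs (4 * m) := by
  classical
  set T := (gaussianSphere m ×ˢ gaussianSphere m).filter
      (fun t => t.1 ≠ t.2 ∧ (t.1 - t.2).norm ≤ (K : ℤ) ^ 2) with hT
  have hmem : ∀ t ∈ T, t.1.norm = m ∧ t.2.norm = m ∧ t.1 ≠ t.2 ∧
      (t.1 - t.2).norm ≤ (K : ℤ) ^ 2 := by
    intro t ht
    simpa [hT, mem_gaussianSphere, and_assoc] using ht
  have hex : ∀ t ∈ T, ∃ s : ℕ × GaussianInt, 0 < s.1 ∧ s.2.norm ∣ ((4 * m : ℕ) : ℤ) ∧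
      t.1 - t.2 = s.1 * s.2 := fun t ht =>
    GaussianInt.exists_natCast_mul_of_norm_eq (hmem t ht).1 (hmem t ht).2.1 (hmem t ht).2.2.1
  choose! f hf using hex
  let e : GaussianInt × GaussianInt → (ℕ × GaussianInt) × Bool := fun t =>
    (f t, decide (0 ≤ t.1.re * (t.1 - t.2).im - t.1.im * (t.1 - t.2).re))
  have hinj : Set.InjOn e T := by
    intro t ht u hu h
    have h1 : f t = f u := congrArg Prod.fst h
    have h2 := congrArg Prod.snd h
    simp only [e, decide_eq_decide] at h2
    have h3 : t.1 - t.2 = u.1 - u.2 := by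
      rw [(hf t ht).2.2, (hf u hu).2.2, h1]
    have h4 := GaussianInt.eq_of_sub_eq_of_norm_eq (hmem t ht).1 (hmem t ht).2.1 (hmem u hu).1
      (hmem u hu).2.1 (hmem t ht).2.2.1 h3 h2
    exact Prod.ext h4.1 h4.2
  have hsub : T.image e ⊆ (Finset.Icc 1 K ×ˢ gaussianDivisors (4 * m)) ×ˢ Finset.univ := by
    refine Finset.image_subset_iff.2 fun t ht => ?_
    obtain ⟨h1, h2, h3⟩ := hf t ht
    simp only [Finset.mem_product, Finset.mem_Icc, Finset.mem_univ, and_true, e]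
    refine ⟨⟨h1, ?_⟩, (mem_gaussianDivisors (by positivity)).2 h2⟩
    have h4 := (hmem t ht).2.2.2
    have hw : 0 < (f t).2.norm := by
      refine GaussianInt.norm_pos.2 fun h0 => (hmem t ht).2.2.1 ?_
      rw [← sub_eq_zero, h3, h0, mul_zero]
    rw [h3, Zsqrtd.norm_mul, Zsqrtd.norm_natCast] at h4
    have h5 : ((f t).1 : ℤ) ^ 2 ≤ (K : ℤ) ^ 2 := by nlinarith [sq_nonneg ((f t).1 : ℤ)]
    exact_mod_cast le_of_sq_le_sq h5 (by positivity)
  let g : (ℕ × GaussianInt) × Bool → ℝ := fun s => (s.1.1 : ℝ)⁻¹ * invAbs s.1.2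
  have hg : ∀ s, 0 ≤ g s := fun s => mul_nonneg (by positivity) (invAbs_nonneg _)
  calc ∑ t ∈ T, invAbs (t.1 - t.2) = ∑ t ∈ T, g (e t) :=
        Finset.sum_congr rfl fun t ht => by
          rw [(hf t ht).2.2, invAbs_mul, invAbs_natCast]
    _ = ∑ s ∈ T.image e, g s := (Finset.sum_image hinj).symm
    _ ≤ ∑ s ∈ (Finset.Icc 1 K ×ˢ gaussianDivisors (4 * m)) ×ˢ Finset.univ, g s :=
        Finset.sum_le_sum_of_subset_of_nonneg hsub fun s _ _ => hg s
    _ = 2 * ((∑ k ∈ Finset.Icc 1 K, (k : ℝ)⁻¹) * sumInvAbs (4 * m)) := by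
        rw [Finset.sum_product, Finset.sum_product, sumInvAbs, Finset.sum_mul_sum, Finset.mul_sum]
        refine Finset.sum_congr rfl fun k _ => ?_
        rw [Finset.mul_sum]
        refine Finset.sum_congr rfl fun w _ => ?_
        simp [g, two_mul]
    _ ≤ 2 * ((1 + Real.log K) * sumInvAbs (4 * m)) := by
        have h := harmonic_le_one_add_log K
        rw [harmonic_eq_sum_Icc] at h
        push_cast at h
        gcongr
        exact sumInvAbs_nonneg _
    _ = _ := by ring

theorem sumInvDist_le {m : ℕ} (hm : m ≠ 0) (hN : 0 < latN m) :
    sumInvDist m ≤ 2 * (1 + 2 * Real.log (latN m)) * sumInvAbs (4 * m) + 1 := by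
  set N := latN m with hNdef
  have h := sum_invAbs_sub_near_le hm (N ^ 2)
  rw [Finset.sum_filter] at h
  have hN0 : (0 : ℝ) < N := by exact_mod_cast hN
  have hpt : ∀ t : GaussianInt × GaussianInt, invAbs (t.1 - t.2) ≤
      (if t.1 ≠ t.2 ∧ (t.1 - t.2).norm ≤ ((N ^ 2 : ℕ) : ℤ) ^ 2 then invAbs (t.1 - t.2) else 0) +
        ((N : ℝ) ^ 2)⁻¹ := by
    intro t
    split_ifs with hc
    · have : (0 : ℝ) ≤ ((N : ℝ) ^ 2)⁻¹ := by positivity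
      linarith
    · by_cases h0 : t.1 = t.2
      · rw [h0, sub_self, invAbs_zero]; positivity
      · have hlt : ((N ^ 2 : ℕ) : ℤ) ^ 2 ≤ (t.1 - t.2).norm := by
          by_contra h1
          exact hc ⟨h0, (not_le.1 h1).le⟩
        rw [zero_add, invAbs]
        gcongr
        refine Real.le_sqrt_of_sq_le ?_
        exact_mod_cast hlt
  have hsum := Finset.sum_le_sum fun t (_ : t ∈ gaussianSphere m ×ˢ gaussianSphere m) => hpt t
  rw [Finset.sum_add_distrib, Finset.sum_const, Finset.card_product, card_gaussianSphere,
    ← hNdef, Finset.sum_product] at hsum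
  have h1 : (N * N) • ((N : ℝ) ^ 2)⁻¹ = 1 := by
    rw [nsmul_eq_mul]; push_cast; field_simp
  have h2 : Real.log ((N ^ 2 : ℕ) : ℝ) = 2 * Real.log N := by
    push_cast; rw [Real.log_pow]; norm_num
  rw [h1] at hsum
  rw [h2] at h
  exact hsum.trans (add_le_add_left h 1)

theorem exists_sumInvDist_le_of_mod_four_ne_three {ε : ℝ} (hε : 0 < ε) :
    ∃ C > 0, ∀ m : ℕ, m ≠ 0 → (∀ p : ℕ, p.Prime → p ∣ m → p % 4 ≠ 3) → 0 < latN m →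
      sumInvDist m ≤ C * (latN m : ℝ) ^ ε := by
  obtain ⟨C, hC, hb⟩ := exists_sumInvAbs_le (half_pos hε)
  set c := ((1 - (√((2 : ℕ) : ℝ))⁻¹)⁻¹) ^ 2 with hc
  have hc0 : 0 ≤ c := by positivity
  refine ⟨2 * (1 + 4 / ε) * (c * C) + 1, by positivity, fun m hm hg hN => ?_⟩
  have h4 : sumInvAbs (4 * m) ≤ c * (C * (latN m : ℝ) ^ (ε / 2)) :=
    (sumInvAbs_prime_pow_mul_le Nat.prime_two (by norm_num) hm 2).trans
      (mul_le_mul_of_nonneg_left (hb m hm hg) hc0)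
  have hN1 : (1 : ℝ) ≤ latN m := by exact_mod_cast hN
  have hx1 : 1 ≤ (latN m : ℝ) ^ (ε / 2) := Real.one_le_rpow hN1 (by positivity)
  have hlog : 1 + 2 * Real.log (latN m) ≤ (1 + 4 / ε) * (latN m : ℝ) ^ (ε / 2) := by
    have h := Real.log_le_rpow_div (x := latN m) (by positivity) (half_pos hε)
    have h' : (latN m : ℝ) ^ (ε / 2) / (ε / 2) = 2 / ε * (latN m : ℝ) ^ (ε / 2) := by
      field_simp
    rw [h'] at h
    have h'' : (1 + 4 / ε) * (latN m : ℝ) ^ (ε / 2) =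
      (latN m : ℝ) ^ (ε / 2) + 2 * (2 / ε * (latN m : ℝ) ^ (ε / 2)) := by ring
    linarith
  have hsq : (latN m : ℝ) ^ ε = (latN m : ℝ) ^ (ε / 2) * (latN m : ℝ) ^ (ε / 2) := by
    rw [← Real.rpow_add (by linarith), add_halves]
  rw [hsq]
  set x := (latN m : ℝ) ^ (ε / 2) with hx
  have hlog0 := Real.log_nonneg hN1
  calc sumInvDist m ≤ _ := sumInvDist_le hm hN
    _ ≤ 2 * ((1 + 4 / ε) * x) * (c * (C * x)) + 1 := by
      have := sumInvAbs_nonneg (4 * m)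
      gcongr
    _ ≤ 2 * ((1 + 4 / ε) * x) * (c * (C * x)) + x * x := by nlinarith
    _ = _ := by ring

theorem gaussianSphere_eq_image_of_mod_four_eq_three {p m : ℕ} (hp : p.Prime) (hp4 : p % 4 = 3)
    (hpm : p ∣ m) (hN : 0 < latN m) :
    ∃ n, m = p ^ 2 * n ∧ gaussianSphere m = (gaussianSphere n).image fun z => (p : GaussianInt) * z := by
  have := Fact.mk hp
  have hprime := GaussianInt.prime_of_nat_prime_of_mod_four_eq_three p hp4
  have hp0 : ((p : ℤ)) ^ 2 ≠ 0 := pow_ne_zero _ (by exact_mod_cast hp.ne_zero)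
  have hdvd : ∀ z ∈ gaussianSphere m, ∃ w, z = (p : GaussianInt) * w := by
    intro z hz
    rw [mem_gaussianSphere] at hz
    have h1 : (p : GaussianInt) ∣ z * star z := by
      rw [← Zsqrtd.norm_eq_mul_conj, hz]
      exact_mod_cast Nat.cast_dvd_cast hpm
    rcases hprime.dvd_or_dvd h1 with h | ⟨w, hw⟩
    · exact h
    · refine ⟨star w, ?_⟩
      rw [← star_star z, hw, star_mul', star_natCast]
  have hnorm : ∀ w : GaussianInt, ((p : GaussianInt) * w).norm = (p : ℤ) ^ 2 * w.norm := by
    intro w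
    rw [Zsqrtd.norm_mul, Zsqrtd.norm_natCast, sq]
  rw [← card_gaussianSphere, Finset.card_pos] at hN
  obtain ⟨z₀, hz₀⟩ := hN
  obtain ⟨w₀, rfl⟩ := hdvd z₀ hz₀
  rw [mem_gaussianSphere, hnorm, ← GaussianInt.abs_natCast_norm] at hz₀
  have hm : m = p ^ 2 * w₀.norm.natAbs := by exact_mod_cast hz₀.symm
  refine ⟨w₀.norm.natAbs, hm, ?_⟩
  ext z
  rw [Finset.mem_image]
  constructor
  · intro hz
    obtain ⟨w, rfl⟩ := hdvd z hz
    refine ⟨w, ?_, rfl⟩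
    rw [mem_gaussianSphere, hnorm, hm] at hz
    push_cast at hz
    rw [mem_gaussianSphere, mul_left_cancel₀ hp0 hz]
    simp
  · rintro ⟨w, hw, rfl⟩
    rw [mem_gaussianSphere] at hw ⊢
    rw [hnorm, hw, hm]
    push_cast; rfl

theorem exists_sumInvDist_le {ε : ℝ} (hε : 0 < ε) :
    ∃ C > 0, ∀ m : ℕ, m ≠ 0 → 0 < latN m → sumInvDist m ≤ C * (latN m : ℝ) ^ ε := by
  obtain ⟨C, hC, hb⟩ := exists_sumInvDist_le_of_mod_four_ne_three hε
  refine ⟨C, hC, fun m => ?_⟩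
  induction m using Nat.strong_induction_on with
  | _ m ih =>
  intro hm hN
  by_cases hg : ∀ p : ℕ, p.Prime → p ∣ m → p % 4 ≠ 3
  · exact hb m hm hg hN
  push Not at hg
  obtain ⟨p, hp, hpm, hp4⟩ := hg
  obtain ⟨n, rfl, himg⟩ := gaussianSphere_eq_image_of_mod_four_eq_three hp hp4 hpm hN
  have hn : n ≠ 0 := by rintro rfl; simp at hm
  have hlt : n < p ^ 2 * n :=
    lt_mul_of_one_lt_left (Nat.pos_of_ne_zero hn) (Nat.one_lt_pow two_ne_zero hp.one_lt)
  have hinj : Function.Injective fun z => (p : GaussianInt) * z :=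
    mul_right_injective₀ (by exact_mod_cast hp.ne_zero)
  have hcard : latN (p ^ 2 * n) = latN n := by
    rw [← card_gaussianSphere, himg, Finset.card_image_of_injective _ hinj, card_gaussianSphere]
  rw [hcard] at hN ⊢
  refine le_trans ?_ (ih n hlt hn hN)
  unfold sumInvDist
  rw [himg, Finset.sum_image hinj.injOn]
  refine Finset.sum_le_sum fun z _ => ?_
  rw [Finset.sum_image hinj.injOn]
  refine Finset.sum_le_sum fun w _ => ?_
  rw [← mul_sub, invAbs_mul, invAbs_natCast]
  refine mul_le_of_le_one_left (invAbs_nonneg _) (inv_le_one_of_one_le₀ ?_)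
  exact_mod_cast hp.one_le

theorem sum_inv_sqrt_eq_sumInvDist (m : ℕ) :
    ∑ μ ∈ latticeSet m, ∑ ν ∈ latticeSet m,
      (√(((μ.1 : ℝ) - ν.1) ^ 2 + ((μ.2 : ℝ) - ν.2) ^ 2))⁻¹ = sumInvDist m := by
  unfold sumInvDist gaussianSphere
  rw [Finset.sum_image gaussian_mk_injective.injOn]
  refine Finset.sum_congr rfl fun μ _ => ?_
  rw [Finset.sum_image gaussian_mk_injective.injOn]
  refine Finset.sum_congr rfl fun ν _ => ?_
  rw [invAbs, GaussianInt.norm_eq_sq_add_sq]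
  simp

/-- The component `⟨μ/√m, γ'(t)⟩` of the velocity of `γ` along the lattice point `μ`. -/
def latticeAmp (m : ℕ) (γ : ℝ → ℝ × ℝ) (μ : ℤ × ℤ) (t : ℝ) : ℝ :=
  (μ.1 : ℝ) / √(m : ℝ) * (deriv γ t).1 + (μ.2 : ℝ) / √(m : ℝ) * (deriv γ t).2

/-- The phase `2π⟨μ, γ(t)⟩`. -/
def latticePhase (γ : ℝ → ℝ × ℝ) (μ : ℤ × ℤ) (t : ℝ) : ℝ :=
  2 * π * ((μ.1 : ℝ) * (γ t).1 + (μ.2 : ℝ) * (γ t).2)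

theorem hasDerivAt_latticePhase {m : ℕ} (hm : 0 < m) {γ : ℝ → ℝ × ℝ} (hγ : Differentiable ℝ γ)
    (μ : ℤ × ℤ) (t : ℝ) :
    HasDerivAt (latticePhase γ μ) (2 * π * √(m : ℝ) * latticeAmp m γ μ t) t := by
  have hs : √(m : ℝ) ≠ 0 := by positivity
  refine ((hasDerivAt_linear_comb (hγ t).hasDerivAt (μ.1 : ℝ) (μ.2 : ℝ)).const_mul
    (2 * π)).congr_deriv ?_
  unfold latticeAmp
  field_simp

theorem continuous_latticeAmp {γ : ℝ → ℝ × ℝ} (hγ : Continuous (deriv γ)) (m : ℕ) (μ : ℤ × ℤ) :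
    Continuous (latticeAmp m γ μ) := by
  unfold latticeAmp; fun_prop

theorem continuous_latticePhase {γ : ℝ → ℝ × ℝ} (hγ : Continuous γ) (μ : ℤ × ℤ) :
    Continuous (latticePhase γ μ) := by
  unfold latticePhase; fun_prop

theorem latticeAmp_neg (m : ℕ) (γ : ℝ → ℝ × ℝ) (μ : ℤ × ℤ) (t : ℝ) :
    latticeAmp m γ (-μ) t = -latticeAmp m γ μ t := by
  simp [latticeAmp]; ring

theorem latticePhase_neg (γ : ℝ → ℝ × ℝ) (μ : ℤ × ℤ) (t : ℝ) :
    latticePhase γ (-μ) t = -latticePhase γ μ t := by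
  simp [latticePhase]; ring

theorem covFn_eq_sum_cos (m : ℕ) (γ : ℝ → ℝ × ℝ) (s u : ℝ) :
    covFn m γ s u =
      (latN m : ℝ)⁻¹ * ∑ μ ∈ latticeSet m, cos (latticePhase γ μ s - latticePhase γ μ u) := by
  unfold covFn latticePhase
  congr 1
  refine Finset.sum_congr rfl fun μ _ => ?_
  congr 1
  simp only [Prod.fst_sub, Prod.snd_sub]
  ring

theorem covFn12_div_eq {m : ℕ} (hm : 0 < m) {γ : ℝ → ℝ × ℝ} (hγ : Differentiable ℝ γ) (s u : ℝ) :
    covFn12 m γ s u / (4 * π ^ 2 * m) =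
      (latN m : ℝ)⁻¹ * ∑ μ ∈ latticeSet m, latticeAmp m γ μ s * latticeAmp m γ μ u *
        cos (latticePhase γ μ s - latticePhase γ μ u) := by
  have hinner : ∀ s, deriv (fun u => covFn m γ s u) u = (latN m : ℝ)⁻¹ *
      ∑ μ ∈ latticeSet m, sin (latticePhase γ μ s - latticePhase γ μ u) *
        (2 * π * √(m : ℝ) * latticeAmp m γ μ u) := by
    intro s
    simp only [covFn_eq_sum_cos]
    refine (HasDerivAt.const_mul _ (HasDerivAt.fun_sum fun μ _ => ?_)).deriv
    refine ((hasDerivAt_latticePhase hm hγ μ u).const_sub _).cos.congr_deriv ?_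
    ring
  have hm' : √(m : ℝ) ^ 2 = m := sq_sqrt (by positivity)
  have houter : covFn12 m γ s u = (latN m : ℝ)⁻¹ *
      ∑ μ ∈ latticeSet m, (4 * π ^ 2 * m) * (latticeAmp m γ μ s * latticeAmp m γ μ u *
        cos (latticePhase γ μ s - latticePhase γ μ u)) := by
    unfold covFn12
    simp only [hinner]
    refine (HasDerivAt.const_mul _ (HasDerivAt.fun_sum fun μ _ => ?_)).deriv
    refine (((hasDerivAt_latticePhase hm hγ μ s).sub_const _).sin.mul_const _).congr_deriv ?_
    linear_combination (4 * π ^ 2 * latticeAmp m γ μ s * latticeAmp m γ μ u *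
      cos (latticePhase γ μ s - latticePhase γ μ u)) * hm'
  rw [houter, ← Finset.mul_sum]
  have : (m : ℝ) ≠ 0 := by positivity
  field_simp

theorem sum_latticeAmp_mul_sin_eq_zero (m : ℕ) (γ : ℝ → ℝ × ℝ) (s u : ℝ) :
    ∑ μ ∈ latticeSet m, latticeAmp m γ μ s * latticeAmp m γ μ u *
      sin (latticePhase γ μ s - latticePhase γ μ u) = 0 := by
  refine self_eq_neg.mp ?_
  rw [← Finset.sum_neg_distrib]
  refine Finset.sum_equiv (Equiv.neg (ℤ × ℤ)) (fun μ => ?_) fun μ _ => ?_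
  · simp [mem_latticeSet]
  · rw [Equiv.neg_apply, latticeAmp_neg, latticeAmp_neg, latticePhase_neg, latticePhase_neg,
      show -latticePhase γ μ s - -latticePhase γ μ u = -(latticePhase γ μ s - latticePhase γ μ u)
        by ring, sin_neg]
    ring

theorem sq_sum_mul_cos_of_sum_mul_sin_eq_zero {ι : Type*} (S : Finset ι) (x y a b : ι → ℝ)
    (h : ∑ i ∈ S, x i * y i * sin (a i - b i) = 0) :
    (∑ i ∈ S, x i * y i * cos (a i - b i)) ^ 2 = ∑ i ∈ S, ∑ j ∈ S,
      (x i * x j * cos (a i - a j) * (y i * y j * cos (b i - b j)) +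
        x i * x j * sin (a i - a j) * (y i * y j * sin (b i - b j))) := by
  calc (∑ i ∈ S, x i * y i * cos (a i - b i)) ^ 2
      = (∑ i ∈ S, x i * y i * cos (a i - b i)) * (∑ i ∈ S, x i * y i * cos (a i - b i)) +
        (∑ i ∈ S, x i * y i * sin (a i - b i)) * (∑ i ∈ S, x i * y i * sin (a i - b i)) := by
        rw [h]; ring
    _ = _ := by
        rw [Finset.sum_mul_sum, Finset.sum_mul_sum, ← Finset.sum_add_distrib]
        refine Finset.sum_congr rfl fun i _ => ?_
        rw [← Finset.sum_add_distrib]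
        refine Finset.sum_congr rfl fun j _ => ?_
        have h1 : cos (a i - b i) * cos (a j - b j) + sin (a i - b i) * sin (a j - b j) =
            cos (a i - a j) * cos (b i - b j) + sin (a i - a j) * sin (b i - b j) := by
          rw [← cos_sub, ← cos_sub]
          congr 1; ring
        linear_combination (x i * y i * x j * y j) * h1

theorem integral_integral_sum_mul_add_mul {ι : Type*} (S : Finset ι) (L : ℝ) (f g : ι → ℝ → ℝ)
    (hf : ∀ i, Continuous (f i)) (hg : ∀ i, Continuous (g i)) :
    ∫ s in (0:ℝ)..L, ∫ u in (0:ℝ)..L, ∑ i ∈ S, (f i s * f i u + g i s * g i u) =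
      ∑ i ∈ S, ((∫ t in (0:ℝ)..L, f i t) ^ 2 + (∫ t in (0:ℝ)..L, g i t) ^ 2) := by
  have hinner : ∀ s, ∫ u in (0:ℝ)..L, ∑ i ∈ S, (f i s * f i u + g i s * g i u) =
      ∑ i ∈ S, (f i s * (∫ t in (0:ℝ)..L, f i t) + g i s * (∫ t in (0:ℝ)..L, g i t)) := by
    intro s
    rw [intervalIntegral.integral_finsetSum
      fun i _ => Continuous.intervalIntegrable (by fun_prop) _ _]
    refine Finset.sum_congr rfl fun i _ => ?_
    rw [intervalIntegral.integral_add (Continuous.intervalIntegrable (by fun_prop) _ _)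
      (Continuous.intervalIntegrable (by fun_prop) _ _),
      intervalIntegral.integral_const_mul, intervalIntegral.integral_const_mul]
  simp only [hinner]
  rw [intervalIntegral.integral_finsetSum
    fun i _ => Continuous.intervalIntegrable (by fun_prop) _ _]
  refine Finset.sum_congr rfl fun i _ => ?_
  rw [intervalIntegral.integral_add (Continuous.intervalIntegrable (by fun_prop) _ _)
    (Continuous.intervalIntegrable (by fun_prop) _ _),
    intervalIntegral.integral_mul_const, intervalIntegral.integral_mul_const]
  ring

theorem integral_integral_covFn12_sq {m : ℕ} (hm : 0 < m) {γ : ℝ → ℝ × ℝ}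
    (hγ : Differentiable ℝ γ) (hγ' : Continuous (deriv γ)) (L : ℝ) :
    ∫ s in (0:ℝ)..L, ∫ u in (0:ℝ)..L, (covFn12 m γ s u / (4 * π ^ 2 * m)) ^ 2 =
      (latN m : ℝ)⁻¹ ^ 2 * ∑ μ ∈ latticeSet m, ∑ ν ∈ latticeSet m,
        ((∫ t in (0:ℝ)..L, latticeAmp m γ μ t * latticeAmp m γ ν t *
            cos (latticePhase γ μ t - latticePhase γ ν t)) ^ 2 +
          (∫ t in (0:ℝ)..L, latticeAmp m γ μ t * latticeAmp m γ ν t *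
            sin (latticePhase γ μ t - latticePhase γ ν t)) ^ 2) := by
  have ha := continuous_latticeAmp hγ' m
  have hp := continuous_latticePhase hγ.continuous
  rw [← Finset.sum_product', ← integral_integral_sum_mul_add_mul (latticeSet m ×ˢ latticeSet m) L
    (fun i t => latticeAmp m γ i.1 t * latticeAmp m γ i.2 t *
      cos (latticePhase γ i.1 t - latticePhase γ i.2 t))
    (fun i t => latticeAmp m γ i.1 t * latticeAmp m γ i.2 t *
      sin (latticePhase γ i.1 t - latticePhase γ i.2 t))
    (fun i => ((ha _).mul (ha _)).mul (continuous_cos.comp ((hp _).sub (hp _))))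
    (fun i => ((ha _).mul (ha _)).mul (continuous_sin.comp ((hp _).sub (hp _)))),
    ← intervalIntegral.integral_const_mul]
  simp only [← intervalIntegral.integral_const_mul]
  congr 1; ext s; congr 1; ext u
  rw [covFn12_div_eq hm hγ, mul_pow, sq_sum_mul_cos_of_sum_mul_sin_eq_zero _ _ _ _ _
    (sum_latticeAmp_mul_sin_eq_zero m γ s u), Finset.sum_product]

theorem Bconst_eq_sum (m : ℕ) {γ : ℝ → ℝ × ℝ} (hγ' : Continuous (deriv γ)) (L : ℝ) :
    Bconst m γ L = (latN m : ℝ)⁻¹ *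
      ∑ μ ∈ latticeSet m, (∫ t in (0:ℝ)..L, latticeAmp m γ μ t * latticeAmp m γ μ t) ^ 2 := by
  have ha := continuous_latticeAmp hγ' m
  have h := integral_integral_sum_mul_add_mul (latticeSet m) L
    (fun μ t => latticeAmp m γ μ t * latticeAmp m γ μ t) (fun _ _ => 0)
    (fun μ => (ha μ).mul (ha μ)) (fun _ => continuous_const)
  simp only [mul_zero, add_zero, intervalIntegral.integral_zero, ne_eq, OfNat.ofNat_ne_zero,
    not_false_eq_true, zero_pow] at h
  rw [← h, ← intervalIntegral.integral_const_mul]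
  simp only [← intervalIntegral.integral_const_mul]
  unfold Bconst
  congr 1; ext s; congr 1; ext u
  congr 1
  refine Finset.sum_congr rfl fun μ hμ => ?_
  have hμ' : (μ.1 : ℝ) ^ 2 + (μ.2 : ℝ) ^ 2 = m := by exact_mod_cast mem_latticeSet.mp hμ
  rw [hμ', sq, sq]
  rfl

theorem exists_offDiagonal_le {L : ℝ} (hL : 0 < L) {γ : ℝ → ℝ × ℝ}
    (hγ : ContDiff ℝ (⊤ : ℕ∞) γ)
    (hunit : ∀ t ∈ Set.Icc (0:ℝ) L, (deriv γ t).1 ^ 2 + (deriv γ t).2 ^ 2 = 1)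
    (hcurv : ∀ t ∈ Set.Icc (0:ℝ) L, deriv (deriv γ) t ≠ 0) :
    ∃ C > 0, ∀ m : ℕ, 0 < m → ∀ μ ∈ latticeSet m, ∀ ν ∈ latticeSet m, μ ≠ ν →
      (∫ t in (0:ℝ)..L, latticeAmp m γ μ t * latticeAmp m γ ν t *
          cos (latticePhase γ μ t - latticePhase γ ν t)) ^ 2 +
        (∫ t in (0:ℝ)..L, latticeAmp m γ μ t * latticeAmp m γ ν t *
          sin (latticePhase γ μ t - latticePhase γ ν t)) ^ 2 ≤
      C * (√(((μ.1 : ℝ) - ν.1) ^ 2 + ((μ.2 : ℝ) - ν.2) ^ 2))⁻¹ := by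
  obtain ⟨C, hC, hb⟩ := exists_integral_mul_cos_sq_le hL hγ hunit hcurv
  refine ⟨2 * C, by positivity, fun m hm μ hμ ν hν hne => ?_⟩
  have hunit_coord : ∀ κ ∈ latticeSet m,
      ((κ.1 : ℝ) / √(m : ℝ)) ^ 2 + ((κ.2 : ℝ) / √(m : ℝ)) ^ 2 ≤ 1 := by
    intro κ hκ
    have h : (κ.1 : ℝ) ^ 2 + (κ.2 : ℝ) ^ 2 = m := by exact_mod_cast mem_latticeSet.mp hκ
    have hm' : (m : ℝ) ≠ 0 := by positivity
    rw [div_pow, div_pow, sq_sqrt (by positivity), ← add_div, h, div_self hm']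
  have hsep : 1 ≤ ((μ.1 : ℝ) - ν.1) ^ 2 + ((μ.2 : ℝ) - ν.2) ^ 2 := by
    have : 0 < (μ.1 - ν.1) ^ 2 + (μ.2 - ν.2) ^ 2 := by
      by_contra! h
      refine hne (Prod.ext ?_ ?_)
      · nlinarith [sq_nonneg (μ.1 - ν.1), sq_nonneg (μ.2 - ν.2)]
      · nlinarith [sq_nonneg (μ.1 - ν.1), sq_nonneg (μ.2 - ν.2)]
    exact_mod_cast this
  have hphase : ∀ t, latticePhase γ μ t - latticePhase γ ν t =
      2 * π * (((μ.1 : ℝ) - ν.1) * (γ t).1 + ((μ.2 : ℝ) - ν.2) * (γ t).2) := fun t => by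
    unfold latticePhase; ring
  have hbound := fun c => hb _ _ _ _ _ _ c (hunit_coord μ hμ) (hunit_coord ν hν) hsep
  have hcos := hbound 0
  have hsin := hbound (-(π / 2))
  simp only [add_zero] at hcos
  simp only [← sub_eq_add_neg, cos_sub_pi_div_two] at hsin
  simp only [hphase]
  calc _ ≤ _ := add_le_add hcos hsin
    _ = _ := by ring

/-- Second moment of the normalized mixed second derivative of the covariance function:
`∫∫ (r₁₂/(4π²m))² = B_𝒞(E)/N + O(N^{ε−2})`. -/
theorem second_moment_covariance_deriv12
    (L : ℝ) (hL : 0 < L) (γ : ℝ → ℝ × ℝ) (hγ : ContDiff ℝ (⊤ : ℕ∞) γ)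
    (hunit : ∀ t ∈ Set.Icc (0:ℝ) L, (deriv γ t).1 ^ 2 + (deriv γ t).2 ^ 2 = 1)
    (hcurv : ∀ t ∈ Set.Icc (0:ℝ) L, deriv (deriv γ) t ≠ 0) :
    ∀ ε > (0:ℝ), ∃ C > 0, ∀ m : ℕ, 0 < m →
      (∃ a b : ℤ, a ^ 2 + b ^ 2 = (m : ℤ)) →
      |(∫ t₁ in (0:ℝ)..L, ∫ t₂ in (0:ℝ)..L,
            (covFn12 m γ t₁ t₂ / (4 * π ^ 2 * m)) ^ 2)
          - Bconst m γ L / latN m|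
        ≤ C * (latN m : ℝ) ^ (ε - 2) := by
  intro ε hε
  obtain ⟨C₁, hC₁, hoff⟩ := exists_offDiagonal_le hL hγ hunit hcurv
  obtain ⟨C₂, hC₂, hsum⟩ := exists_sumInvDist_le hε
  refine ⟨C₁ * C₂, by positivity, fun m hm ⟨a, b, hab⟩ => ?_⟩
  have hN : 0 < latN m := Finset.card_pos.mpr ⟨(a, b), mem_latticeSet.mpr hab⟩
  have hN' : (0 : ℝ) < latN m := by exact_mod_cast hN
  have hγ' : Continuous (deriv γ) := hγ.continuous_deriv (by norm_cast)
  rw [integral_integral_covFn12_sq hm (hγ.differentiable (by simp)) hγ', Bconst_eq_sum m hγ',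
    show ∀ x : ℝ, (latN m : ℝ)⁻¹ * x / latN m = (latN m : ℝ)⁻¹ ^ 2 * x from
      fun x => by field_simp, ← mul_sub, abs_mul, abs_of_nonneg (by positivity),
    ← Finset.sum_sub_distrib]
  have hterm : ∀ μ ∈ latticeSet m,
      |∑ ν ∈ latticeSet m,
        ((∫ t in (0:ℝ)..L, latticeAmp m γ μ t * latticeAmp m γ ν t *
            cos (latticePhase γ μ t - latticePhase γ ν t)) ^ 2 +
          (∫ t in (0:ℝ)..L, latticeAmp m γ μ t * latticeAmp m γ ν t *
            sin (latticePhase γ μ t - latticePhase γ ν t)) ^ 2) -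
        (∫ t in (0:ℝ)..L, latticeAmp m γ μ t * latticeAmp m γ μ t) ^ 2| ≤
      C₁ * ∑ ν ∈ latticeSet m, (√(((μ.1 : ℝ) - ν.1) ^ 2 + ((μ.2 : ℝ) - ν.2) ^ 2))⁻¹ := by
    intro μ hμ
    rw [← Finset.add_sum_erase _ _ hμ, ← Finset.add_sum_erase _ _ hμ]
    simp only [sub_self, cos_zero, sin_zero, mul_one, mul_zero, intervalIntegral.integral_zero,
      ne_eq, OfNat.ofNat_ne_zero, not_false_eq_true, zero_pow, add_zero, add_sub_cancel_left,
      sqrt_zero, inv_zero, zero_add]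
    rw [abs_of_nonneg (Finset.sum_nonneg fun ν _ => by positivity), Finset.mul_sum]
    refine Finset.sum_le_sum fun ν hν => ?_
    exact hoff m hm μ hμ ν (Finset.mem_of_mem_erase hν) (Finset.ne_of_mem_erase hν).symm
  calc _ ≤ (latN m : ℝ)⁻¹ ^ 2 * (C₁ * sumInvDist m) := by
        gcongr
        rw [← sum_inv_sqrt_eq_sumInvDist, Finset.mul_sum]
        exact (Finset.abs_sum_le_sum_abs _ _).trans (Finset.sum_le_sum hterm)
    _ ≤ (latN m : ℝ)⁻¹ ^ 2 * (C₁ * (C₂ * (latN m : ℝ) ^ ε)) := by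
        gcongr
        exact hsum m hm.ne' hN
    _ = C₁ * C₂ * (latN m : ℝ) ^ (ε - 2) := by
        rw [rpow_sub hN', rpow_two]
        field_simp

end
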